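/- Assume k ≤ 3, and set α_2 = 1/49, Δ = 3 when k = 2, and α_3 = (8·(9·log_4(3) − 1))^{−1}, Δ = 2 when k = 3. Then the set {x ∈ F : x has a base-b expansion ω with digits in A such that B_ω contains an infinite arithmetic progression with common difference Δ} has Hausdorff dimension at least α_k·δ, where δ = log k / log b. -/

import Mathlib

/-- The real number in `[0,1]` whose base-`b` digit sequence is `ω` (so that
`ω 0` is the first digit after the point). -/
noncomputable def baseVal (b : ℕ) (ω : ℕ → ℕ) : ℝ :=
  ∑' i : ℕ, (ω i : ℝ) / (b : ℝ) ^ (i + 1)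

/-- The initial segment of `ω` of length `A.card ^ n + n - 1` is a (non-cyclic)
de Bruijn sequence of order `n` in the alphabet `A`: every word of length `n`
over `A` occurs exactly once as a consecutive substring of that initial segment. -/
def dbPrefix (A : Finset ℕ) (n : ℕ) (ω : ℕ → ℕ) : Prop :=
  ∀ v : ℕ → ℕ, (∀ i < n, v i ∈ A) →
    ∃! j : ℕ, j + n ≤ A.card ^ n + n - 1 ∧ ∀ i < n, ω (j + i) = v i

/-- `B_ω`, the set of orders `n ≥ 1` for which the corresponding initial segment of `ω`
is a de Bruijn sequence of order `n`. -/
def deBruijnSet (A : Finset ℕ) (ω : ℕ → ℕ) : Set ℕ :=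
  {n | 0 < n ∧ dbPrefix A n ω}

/-- `ω` is uniformly de Bruijn: `B_ω` is infinite with bounded gap sizes. -/
def UniformlyDeBruijn (A : Finset ℕ) (ω : ℕ → ℕ) : Prop :=
  ∃ g : ℕ, ∀ N : ℕ, ∃ n ∈ deBruijnSet A ω, N < n ∧ n ≤ N + g

/-- `ω` is infinitely de Bruijn: `B_ω` is infinite. -/
def InfinitelyDeBruijn (A : Finset ℕ) (ω : ℕ → ℕ) : Prop :=
  (deBruijnSet A ω).Infinite

/-- `ω` is totally de Bruijn: `B_ω` contains every `n ≥ 1`. -/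
def TotallyDeBruijn (A : Finset ℕ) (ω : ℕ → ℕ) : Prop :=
  ∀ n : ℕ, 0 < n → dbPrefix A n ω

/-- The limit set `F` of the base-`b` IFS with digit alphabet `A`: all reals having at
least one base-`b` expansion with all digits in `A`. -/
def limitSet (b : ℕ) (A : Finset ℕ) : Set ℝ :=
  {x | ∃ ω : ℕ → ℕ, (∀ i, ω i ∈ A) ∧ x = baseVal b ω}



section Graph
open Classical
set_option linter.unusedSectionVars false

/-- Vertex reached after `j` steps from `s` reading the labels `c`. -/
def vtx {V α : Type} (nxt : V → α → V) (s : V) (c : ℕ → α) : ℕ → V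
  | 0 => s
  | j + 1 => nxt (vtx nxt s c j) (c j)

/-- The `j`-th edge of the walk. -/
def edg {V α : Type} (nxt : V → α → V) (s : V) (c : ℕ → α) (j : ℕ) : V × α :=
  (vtx nxt s c j, c j)

theorem vtx_congr {V α : Type} (nxt : V → α → V) (s : V) (c c' : ℕ → α) (L : ℕ)
    (h : ∀ i < L, c i = c' i) (j : ℕ) (hj : j ≤ L) : vtx nxt s c j = vtx nxt s c' j := by
  induction j with
  | zero => rfl
  | succ j ih => simp only [vtx]; rw [ih (by omega), h j (by omega)]

theorem edg_congr {V α : Type} (nxt : V → α → V) (s : V) (c c' : ℕ → α) (L : ℕ)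
    (h : ∀ i < L, c i = c' i) (j : ℕ) (hj : j < L) : edg nxt s c j = edg nxt s c' j := by
  simp only [edg]; rw [vtx_congr nxt s c c' L h j hj.le, h j hj]

theorem balance {V α : Type} (nxt : V → α → V) (s : V) (c : ℕ → α) (L : ℕ) (y : V) :
    ((Finset.range L).filter (fun j => vtx nxt s c (j+1) = y)).card + (if y = s then 1 else 0)
    = ((Finset.range L).filter (fun j => vtx nxt s c j = y)).card
      + (if y = vtx nxt s c L then 1 else 0) := by
  induction L with
  | zero => rw [Finset.range_zero, Finset.filter_empty, Finset.filter_empty]; rfl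
  | succ L ih =>
    rw [Finset.range_add_one, Finset.filter_insert, Finset.filter_insert]
    have n1 : L ∉ (Finset.range L).filter (fun j => vtx nxt s c (j+1) = y) := by simp
    have n2 : L ∉ (Finset.range L).filter (fun j => vtx nxt s c j = y) := by simp
    have i1 : (if y = vtx nxt s c (L+1) then 1 else 0) =
        (if vtx nxt s c (L+1) = y then 1 else 0) := by simp only [eq_comm]
    have i2 : (if y = vtx nxt s c L then 1 else 0) =
        (if vtx nxt s c L = y then 1 else 0) := by simp only [eq_comm]
    rw [i1]
    rw [i2] at ih
    by_cases a1 : vtx nxt s c (L+1) = y <;> by_cases a2 : vtx nxt s c L = y <;>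
      simp only [a1, a2, if_true, if_false, Finset.card_insert_of_notMem n1,
        Finset.card_insert_of_notMem n2] at ih ⊢ <;> omega

variable {V α : Type} [Fintype V] [Fintype α]

theorem out_le (nxt : V → α → V) (s : V) (c : ℕ → α) (L : ℕ)
    (hinj : Set.InjOn (edg nxt s c) (Set.Iio L)) (y : V) :
    ((Finset.range L).filter (fun j => vtx nxt s c j = y)).card ≤ Fintype.card α := by
  rw [← Finset.card_univ]
  apply Finset.card_le_card_of_injOn c (by simp)
  intro i hi j hj hij
  simp at hi hj
  apply hinj hi.1 hj.1
  simp [edg, hi.2, hj.2, hij]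

theorem out_eq (nxt : V → α → V) (s : V) (c : ℕ → α) (L : ℕ)
    (hinj : Set.InjOn (edg nxt s c) (Set.Iio L)) (y : V)
    (hc : ∀ a, ∃ j < L, edg nxt s c j = (y, a)) :
    ((Finset.range L).filter (fun j => vtx nxt s c j = y)).card = Fintype.card α := by
  apply le_antisymm (out_le nxt s c L hinj y)
  rw [← Finset.card_univ]
  apply Finset.card_le_card_of_surjOn c
  intro a _
  obtain ⟨j, hj, h⟩ := hc a
  simp only [edg, Prod.mk.injEq] at h
  exact ⟨j, by simp [hj, h.1], h.2⟩

theorem in_le (nxt : V → α → V) (s : V) (c : ℕ → α) (L : ℕ)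
    (hbal : ∀ y, (Finset.univ.filter (fun e : V × α => nxt e.1 e.2 = y)).card = Fintype.card α)
    (hinj : Set.InjOn (edg nxt s c) (Set.Iio L)) (y : V) :
    ((Finset.range L).filter (fun j => vtx nxt s c (j+1) = y)).card ≤ Fintype.card α := by
  rw [← hbal y]
  apply Finset.card_le_card_of_injOn (edg nxt s c)
  · intro j hj
    have hj2 := (Finset.mem_filter.1 hj).2
    simpa [edg, vtx] using hj2
  · intro i hi j hj hij
    simp at hi hj
    exact hinj hi.1 hj.1 hij

theorem in_full (nxt : V → α → V) (s : V) (c : ℕ → α) (L : ℕ)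
    (hbal : ∀ y, (Finset.univ.filter (fun e : V × α => nxt e.1 e.2 = y)).card = Fintype.card α)
    (hinj : Set.InjOn (edg nxt s c) (Set.Iio L)) (y : V)
    (h : ((Finset.range L).filter (fun j => vtx nxt s c (j+1) = y)).card = Fintype.card α)
    (x : V) (a : α) (hx : nxt x a = y) : ∃ j < L, edg nxt s c j = (x, a) := by
  have : ((Finset.range L).filter (fun j => vtx nxt s c (j+1) = y)).image (edg nxt s c) =
      Finset.univ.filter (fun e : V × α => nxt e.1 e.2 = y) := by
    apply Finset.eq_of_subset_of_card_le
    · intro e he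
      simp only [Finset.mem_image, Finset.mem_filter, Finset.mem_range] at he
      obtain ⟨j, hj, rfl⟩ := he
      simpa [edg, vtx] using hj.2
    · rw [hbal, Finset.card_image_of_injOn, h]
      intro i hi j hj hij
      simp at hi hj
      exact hinj hi.1 hj.1 hij
  have hm : (x, a) ∈ Finset.univ.filter (fun e : V × α => nxt e.1 e.2 = y) := by simp [hx]
  rw [← this] at hm
  simp only [Finset.mem_image, Finset.mem_filter, Finset.mem_range] at hm
  obtain ⟨j, hj, e⟩ := hm
  exact ⟨j, hj.1, e⟩

theorem card_full (nxt : V → α → V) (s : V) (c : ℕ → α) (L : ℕ)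
    (hinj : Set.InjOn (edg nxt s c) (Set.Iio L))
    (h : ∀ x a, ∃ j < L, edg nxt s c j = (x, a)) : L = Fintype.card V * Fintype.card α := by
  have : (Finset.range L).image (edg nxt s c) = Finset.univ := by
    ext ⟨x, a⟩
    simpa using h x a
  rw [← Fintype.card_prod, ← Finset.card_univ, ← this, Finset.card_image_of_injOn, Finset.card_range]
  simpa using hinj

theorem full_of_card (nxt : V → α → V) (s : V) (c : ℕ → α)
    (hinj : Set.InjOn (edg nxt s c) (Set.Iio (Fintype.card V * Fintype.card α))) (x : V) (a : α) :
    ∃ j < Fintype.card V * Fintype.card α, edg nxt s c j = (x, a) := by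
  have : (Finset.range (Fintype.card V * Fintype.card α)).image (edg nxt s c) = Finset.univ := by
    apply Finset.eq_univ_of_card
    rw [Finset.card_image_of_injOn (by simpa using hinj), Finset.card_range, Fintype.card_prod]
  have hm : (x, a) ∈ Finset.univ := Finset.mem_univ (x, a)
  rw [← this] at hm
  simpa using hm

/-- A full trail is closed. -/
theorem closed_of_full (nxt : V → α → V) (s : V) (c : ℕ → α)
    (hbal : ∀ y, (Finset.univ.filter (fun e : V × α => nxt e.1 e.2 = y)).card = Fintype.card α)
    (hinj : Set.InjOn (edg nxt s c) (Set.Iio (Fintype.card V * Fintype.card α))) :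
    vtx nxt s c (Fintype.card V * Fintype.card α) = s := by
  set L := Fintype.card V * Fintype.card α
  have h1 := balance nxt s c L (vtx nxt s c L)
  have h2 := in_le nxt s c L hbal hinj (vtx nxt s c L)
  have h3 := out_eq nxt s c L hinj (vtx nxt s c L) (full_of_card nxt s c hinj _)
  by_contra hne
  rw [if_neg hne, if_pos rfl] at h1
  omega

theorem greedy (nxt : V → α → V) (s : V)
    (hbal : ∀ y, (Finset.univ.filter (fun e : V × α => nxt e.1 e.2 = y)).card = Fintype.card α)
    (w : ℕ → α) (L0 : ℕ) (hL0 : L0 ≤ Fintype.card V * Fintype.card α)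
    (hw : Set.InjOn (edg nxt s w) (Set.Iio L0))
    (π : V → α → ℕ) (h : V → ℕ)
    (htree : ∀ x, x ≠ s → ∃ p, (∀ c, c ≠ p → π x c < π x p) ∧
      (∀ j < L0, edg nxt s w j ≠ (x, p)) ∧ h (nxt x p) < h x) :
    ∃ c : ℕ → α, (∀ i < L0, c i = w i) ∧
      Set.InjOn (edg nxt s c) (Set.Iio (Fintype.card V * Fintype.card α)) ∧
      ∀ j, L0 ≤ j → j < Fintype.card V * Fintype.card α → ∀ a,
        π (vtx nxt s c j) a < π (vtx nxt s c j) (c j) →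
        ∃ j' < j, edg nxt s c j' = (vtx nxt s c j, a) := by
  suffices H : ∀ L, L0 ≤ L → L ≤ Fintype.card V * Fintype.card α →
    ∃ c : ℕ → α, (∀ i < L0, c i = w i) ∧
      Set.InjOn (edg nxt s c) (Set.Iio L) ∧
      ∀ j, L0 ≤ j → j < L → ∀ a,
        π (vtx nxt s c j) a < π (vtx nxt s c j) (c j) →
        ∃ j' < j, edg nxt s c j' = (vtx nxt s c j, a) from H _ hL0 le_rfl
  intro L hL
  induction L, hL using Nat.le_induction with
  | base => exact fun _ => ⟨w, fun _ _ => rfl, hw, fun j h1 h2 => by omega⟩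
  | succ L hL ih =>
    intro hLK
    obtain ⟨c, hc1, hc2, hc3⟩ := ih (by omega)
    set x := vtx nxt s c L with hx
    by_cases hun : ∃ a, ∀ j < L, edg nxt s c j ≠ (x, a)
    · -- extend
      obtain ⟨a, ha, hmin⟩ := Finset.exists_min_image
        (Finset.univ.filter (fun a => ∀ j < L, edg nxt s c j ≠ (x, a))) (π x)
        (by obtain ⟨a, ha⟩ := hun; exact ⟨a, by simpa using ha⟩)
      simp only [Finset.mem_filter, Finset.mem_univ, true_and] at ha hmin
      have hag : ∀ i < L, Function.update c L a i = c i := fun i hi =>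
        Function.update_of_ne (by omega) _ _
      have hE : ∀ j < L, edg nxt s (Function.update c L a) j = edg nxt s c j := fun j hj =>
        edg_congr nxt s _ _ L hag j hj
      have hV : ∀ j ≤ L, vtx nxt s (Function.update c L a) j = vtx nxt s c j := fun j hj =>
        vtx_congr nxt s _ _ L hag j hj
      have hEL : edg nxt s (Function.update c L a) L = (x, a) := by
        simp [edg, hV L le_rfl, hx]
      refine ⟨Function.update c L a, fun i hi => by rw [hag i (by omega), hc1 i hi], ?_, ?_⟩
      · intro i hi j hj hij
        simp only [Set.mem_Iio] at hi hj
        rcases Nat.lt_succ_iff_lt_or_eq.1 hi with hi' | rfl <;>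
        rcases Nat.lt_succ_iff_lt_or_eq.1 hj with hj' | hj'
        · rw [hE i hi', hE j hj'] at hij
          exact hc2 hi' hj' hij
        · subst hj'
          rw [hE i hi', hEL] at hij
          exact absurd hij (ha i hi')
        · rw [hE j hj', hEL] at hij
          exact absurd hij.symm (ha j hj')
        · exact hj'.symm
      · intro j hj1 hj2 a' hlt
        rcases Nat.lt_succ_iff_lt_or_eq.1 hj2 with hj' | rfl
        · rw [hV j hj'.le, hag j hj'] at hlt
          obtain ⟨j', h1, h2⟩ := hc3 j hj1 hj' a' hlt
          exact ⟨j', h1, by rw [hE j' (by omega), hV j hj'.le]; exact h2⟩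
        · rw [hV j le_rfl, Function.update_self, ← hx] at hlt
          by_contra hcon
          push Not at hcon
          have := hmin a' (fun j' hj' => by
            have := hcon j' hj'
            rwa [hE j' hj', hV j le_rfl, ← hx] at this)
          omega
    · exfalso
      push Not at hun
      have hxs : x = s := by
        have h1 := balance nxt s c L x
        have h2 := in_le nxt s c L hbal hc2 x
        have h3 := out_eq nxt s c L hc2 x hun
        by_contra hne
        rw [if_neg hne, if_pos hx] at h1
        omega
      have hbal' : ∀ y, ((Finset.range L).filter (fun j => vtx nxt s c (j+1) = y)).card =
          ((Finset.range L).filter (fun j => vtx nxt s c j = y)).card := by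
        intro y
        have h1 := balance nxt s c L y
        rw [← hx, hxs] at h1
        omega
      have hall : ∀ n, ∀ y, h y < n → ∀ a, ∃ j < L, edg nxt s c j = (y, a) := by
        intro n
        induction n with
        | zero => intro y hy; omega
        | succ n ihn =>
          intro y hy a
          by_cases hys : y = s
          · obtain ⟨j, h1, h2⟩ := hun a
            exact ⟨j, h1, by rw [h2, hxs, hys]⟩
          obtain ⟨p, hp1, hp2, hp3⟩ := htree y hys
          have hz := ihn (nxt y p) (by omega)
          have hin := in_full nxt s c L hbal hc2 (nxt y p)
            (by rw [hbal', out_eq nxt s c L hc2 _ hz]) y p rfl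
          obtain ⟨j, hj, hje⟩ := hin
          by_cases hap : a = p
          · exact ⟨j, hj, by rw [hje, hap]⟩
          have hjL : L0 ≤ j := by
            by_contra hlt
            push Not at hlt
            apply hp2 j hlt
            rw [← hje]
            exact (edg_congr nxt s c w L0 hc1 j hlt).symm
          simp only [edg, Prod.mk.injEq] at hje
          obtain ⟨j', h1, h2⟩ := hc3 j hjL hj a (by rw [hje.1, hje.2]; exact hp1 a hap)
          exact ⟨j', by omega, by rw [h2, hje.1]⟩
      have := card_full nxt s c L hc2 (fun y => hall _ y (Nat.lt_succ_self _))
      omega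

/-- Vertices from which `s` is reached in exactly `n` steps through the edges in `U`. -/
def lev {V α : Type} (nxt : V → α → V) (s : V) (U : V → α → Prop) : ℕ → Set V
  | 0 => {s}
  | n + 1 => {x | ∃ a, U x a ∧ nxt x a ∈ lev nxt s U n}

/-- Reachability of the root in the remaining graph, from weak connectivity. -/
theorem reach (nxt : V → α → V) (s : V)
    (hbal : ∀ y, (Finset.univ.filter (fun e : V × α => nxt e.1 e.2 = y)).card = Fintype.card α)
    (w : ℕ → α) (L0 : ℕ) (hw : Set.InjOn (edg nxt s w) (Set.Iio L0))
    (hconn : ∀ Y : Set V, s ∈ Y →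
      (∀ x a, (∀ j < L0, edg nxt s w j ≠ (x, a)) → (x ∈ Y ↔ nxt x a ∈ Y)) → ∀ x, x ∈ Y) :
    ∃ h : V → ℕ, ∀ x, x ≠ s → ∃ p, (∀ j < L0, edg nxt s w j ≠ (x, p)) ∧ h (nxt x p) < h x := by
  set D : ℕ → Set V := lev nxt s (fun x a => ∀ j < L0, edg nxt s w j ≠ (x, a))
  have hD0 : D 0 = {s} := rfl
  have hDs : ∀ n, D (n+1) = {x | ∃ a, (∀ j < L0, edg nxt s w j ≠ (x, a)) ∧ nxt x a ∈ D n} :=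
    fun n => rfl
  have hall : ∀ x, ∃ n, x ∈ D n := by
    apply hconn {x | ∃ n, x ∈ D n} ⟨0, rfl⟩
    set Y : Set V := {x | ∃ n, x ∈ D n} with hY
    have hsY : s ∈ Y := ⟨0, rfl⟩
    have hback : ∀ x a, (∀ j < L0, edg nxt s w j ≠ (x, a)) → nxt x a ∈ Y → x ∈ Y := by
      rintro x a hx ⟨n, hn⟩
      exact ⟨n+1, by rw [hDs]; exact ⟨a, hx, hn⟩⟩
    let g : V × α → ℤ := fun e : V × α =>
      (if nxt e.1 e.2 ∈ Y then (1:ℤ) else 0) - (if (Prod.fst e : V) ∈ (Y : Set V) then (1:ℤ) else 0)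
    have htot : ∑ e, g e = 0 := by
      simp only [g, Finset.sum_sub_distrib]
      rw [sub_eq_zero]
      have e1 : ∑ e : V × α, (if nxt e.1 e.2 ∈ Y then (1:ℤ) else 0)
          = ∑ y : V, ∑ e ∈ Finset.univ.filter (fun e : V × α => nxt e.1 e.2 = y),
            (if y ∈ Y then (1:ℤ) else 0) := by
        rw [← Finset.sum_fiberwise (s := Finset.univ) (g := fun e : V × α => nxt e.1 e.2)]
        apply Finset.sum_congr rfl
        intro y _
        apply Finset.sum_congr rfl
        intro e he
        rw [(Finset.mem_filter.1 he).2]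
      rw [e1, Fintype.sum_prod_type]
      apply Finset.sum_congr rfl
      intro y _
      show _ = ∑ _a : α, (if y ∈ Y then (1:ℤ) else 0)
      rw [Finset.sum_const, Finset.sum_const, hbal, Finset.card_univ]
    have husedsum : ∑ e ∈ (Finset.range L0).image (edg nxt s w), g e ≤ 0 := by
      rw [Finset.sum_image (by simpa using hw)]
      have : ∀ j, g (edg nxt s w j) = (if vtx nxt s w (j+1) ∈ Y then (1:ℤ) else 0)
        - (if vtx nxt s w j ∈ Y then (1:ℤ) else 0) := fun j => rfl
      simp only [this]
      rw [Finset.sum_range_sub (fun j => if vtx nxt s w j ∈ Y then (1:ℤ) else 0)]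
      simp only [vtx, hsY, if_true]
      split_ifs <;> norm_num
    have hsplit := Finset.sum_add_sum_compl ((Finset.range L0).image (edg nxt s w)) g
    rw [htot] at hsplit
    have hle : ∀ e ∈ ((Finset.range L0).image (edg nxt s w))ᶜ, g e ≤ 0 := by
      intro e he
      simp only [Finset.mem_compl, Finset.mem_image, Finset.mem_range, not_exists, not_and] at he
      have hb := hback e.1 e.2 (fun j hj => he j hj)
      simp only [g]
      by_cases q1 : nxt e.1 e.2 ∈ Y
      · rw [if_pos q1, if_pos (hb q1)]; norm_num
      · rw [if_neg q1]
        split_ifs <;> norm_num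
    have hz : ∑ e ∈ ((Finset.range L0).image (edg nxt s w))ᶜ, g e = 0 :=
      le_antisymm (Finset.sum_nonpos hle) (by linarith)
    rw [Finset.sum_eq_zero_iff_of_nonpos hle] at hz
    intro x a hx
    refine ⟨fun hxY => ?_, hback x a hx⟩
    have := hz (x, a) (by
      simp only [Finset.mem_compl, Finset.mem_image, Finset.mem_range, not_exists, not_and]
      exact hx)
    by_contra hn
    simp [g, hxY, hn] at this
  refine ⟨fun x => sInf {n | x ∈ D n}, ?_⟩
  intro x hxs
  have hsp : x ∈ D (sInf {n | x ∈ D n}) := Nat.sInf_mem (hall x)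
  rcases hn : sInf {n | x ∈ D n} with _ | n
  · rw [hn, hD0] at hsp
    exact absurd hsp hxs
  · rw [hn, hDs] at hsp
    obtain ⟨a, h1, h2⟩ := hsp
    refine ⟨a, h1, ?_⟩
    have : sInf {n | nxt x a ∈ D n} ≤ n := Nat.sInf_le h2
    simp only [hn]
    omega

theorem euler (nxt : V → α → V) (s : V)
    (hbal : ∀ y, (Finset.univ.filter (fun e : V × α => nxt e.1 e.2 = y)).card = Fintype.card α)
    (w : ℕ → α) (L0 : ℕ) (hL0 : L0 ≤ Fintype.card V * Fintype.card α)
    (hw : Set.InjOn (edg nxt s w) (Set.Iio L0))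
    (hconn : ∀ Y : Set V, s ∈ Y →
      (∀ x a, (∀ j < L0, edg nxt s w j ≠ (x, a)) → (x ∈ Y ↔ nxt x a ∈ Y)) → ∀ x, x ∈ Y) :
    ∃ c : ℕ → α, (∀ i < L0, c i = w i) ∧
      Set.InjOn (edg nxt s c) (Set.Iio (Fintype.card V * Fintype.card α)) := by
  obtain ⟨h, hh⟩ := reach nxt s hbal w L0 hw hconn
  have : ∀ x, ∃ p, x ≠ s → (∀ j < L0, edg nxt s w j ≠ (x, p)) ∧ h (nxt x p) < h x := by
    intro x
    by_cases hx : x = s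
    · exact ⟨w 0, fun h => absurd hx h⟩
    · obtain ⟨p, hp⟩ := hh x hx
      exact ⟨p, fun _ => hp⟩
  choose p hp using this
  obtain ⟨c, h1, h2, -⟩ := greedy nxt s hbal w L0 hL0 hw (fun x a => if a = p x then 1 else 0) h
    (fun x hx => ⟨p x, fun a ha => by simp [ha], hp x hx⟩)
  exact ⟨c, h1, h2⟩

/-- Many trails. -/
theorem many (nxt : V → α → V) (s : V)
    (hbal : ∀ y, (Finset.univ.filter (fun e : V × α => nxt e.1 e.2 = y)).card = Fintype.card α)
    (w : ℕ → α) (L0 : ℕ) (hL0 : L0 ≤ Fintype.card V * Fintype.card α)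
    (hw : Set.InjOn (edg nxt s w) (Set.Iio L0))
    (h : V → ℕ) (P : V → α) (I J : Set V)
    (H1 : ∀ x, x ≠ s → x ∈ J → (∀ j < L0, edg nxt s w j ≠ (x, P x)) ∧ h (nxt x (P x)) < h x)
    (H2 : ∀ x, x ≠ s → x ∉ J → ∀ a, (∀ j < L0, edg nxt s w j ≠ (x, a)) ∧ h (nxt x a) < h x)
    (H3 : ∀ x, x ∈ I → ∃ c₁ c₂, c₁ ≠ c₂ ∧ (∀ j < L0, edg nxt s w j ≠ (x, c₁)) ∧
      (∀ j < L0, edg nxt s w j ≠ (x, c₂)) ∧ (x ∈ J → c₁ ≠ P x ∧ c₂ ≠ P x)) :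
    ∃ E : (V → Bool) → ℕ → α, (∀ f, ∀ i < L0, E f i = w i) ∧
      (∀ f, Set.InjOn (edg nxt s (E f)) (Set.Iio (Fintype.card V * Fintype.card α))) ∧
      ∀ f f', (∀ i < Fintype.card V * Fintype.card α, E f i = E f' i) → ∀ x ∈ I, f x = f' x := by
  let e : α → ℕ := fun a => (Fintype.equivFin α a : ℕ)
  have he : ∀ a, e a < Fintype.card α := fun a => (Fintype.equivFin α a).2
  have heinj : ∀ a b, e a = e b → a = b := fun a b hab => by
    apply (Fintype.equivFin α).injective
    exact Fin.ext hab
  let π : (V → Bool) → V → α → ℕ := fun f x a =>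
    if x ∈ J ∧ a = P x then 2 * Fintype.card α else if f x then e a else Fintype.card α - e a
  have hex : ∀ f, ∃ c : ℕ → α, (∀ i < L0, c i = w i) ∧
      Set.InjOn (edg nxt s c) (Set.Iio (Fintype.card V * Fintype.card α)) ∧
      ∀ j, L0 ≤ j → j < Fintype.card V * Fintype.card α → ∀ a,
        π f (vtx nxt s c j) a < π f (vtx nxt s c j) (c j) →
        ∃ j' < j, edg nxt s c j' = (vtx nxt s c j, a) := by
    intro f
    apply greedy nxt s hbal w L0 hL0 hw (π f) h
    intro x hx
    by_cases hxJ : x ∈ J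
    · refine ⟨P x, fun a ha => ?_, H1 x hx hxJ⟩
      have := he a
      simp only [π, hxJ, ha, and_false, if_false, and_true, if_true]
      split_ifs <;> omega
    · obtain ⟨p, -, hp⟩ := Finset.exists_max_image Finset.univ (π f x) ⟨w 0, Finset.mem_univ _⟩
      refine ⟨p, fun a ha => ?_, H2 x hx hxJ p⟩
      apply lt_of_le_of_ne (hp a (Finset.mem_univ _))
      intro heq
      apply ha
      apply heinj
      have h1 := he a
      have h2 := he p
      simp only [π, hxJ, false_and, if_false] at heq
      split_ifs at heq <;> omega
  choose E hE1 hE2 hE3 using hex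
  refine ⟨E, hE1, hE2, ?_⟩
  intro f f' hff x hxI
  obtain ⟨c₁, c₂, hne, hu1, hu2, hJ⟩ := H3 x hxI
  obtain ⟨j₁, hj1, e1⟩ := full_of_card nxt s (E f) (hE2 f) x c₁
  obtain ⟨j₂, hj2, e2⟩ := full_of_card nxt s (E f) (hE2 f) x c₂
  have key : ∀ g, (∀ i < Fintype.card V * Fintype.card α, E f i = E g i) →
      (π g x c₁ < π g x c₂ → j₁ < j₂) ∧ (π g x c₂ < π g x c₁ → j₂ < j₁) := by
    intro g hg
    have hgE : ∀ j < Fintype.card V * Fintype.card α, edg nxt s (E g) j = edg nxt s (E f) j :=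
      fun j hj => (edg_congr nxt s _ _ _ hg j hj).symm
    have main : ∀ a b ja jb, ja < Fintype.card V * Fintype.card α →
        jb < Fintype.card V * Fintype.card α → edg nxt s (E f) ja = (x, a) →
        edg nxt s (E f) jb = (x, b) → (∀ j < L0, edg nxt s w j ≠ (x, b)) →
        π g x a < π g x b → ja < jb := by
      intro a b ja jb hja hjb ea eb hub hlt
      have hL : L0 ≤ jb := by
        by_contra hcon
        push Not at hcon
        apply hub jb hcon
        rw [← eb]
        exact (edg_congr nxt s _ _ _ (hE1 f) jb hcon).symm
      have eb' := eb
      rw [← hgE jb hjb] at eb'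
      simp only [edg, Prod.mk.injEq] at eb'
      obtain ⟨j', h1, h2⟩ := hE3 g jb hL hjb a (by rw [eb'.1, eb'.2]; exact hlt)
      rw [hgE j' (by omega), eb'.1] at h2
      have : j' = ja := hE2 f (by simp; omega) hja (by rw [h2, ea])
      omega
    exact ⟨main _ _ _ _ hj1 hj2 e1 e2 hu2, main _ _ _ _ hj2 hj1 e2 e1 hu1⟩
  have k1 := key f (fun _ _ => rfl)
  have k2 := key f' hff
  have hee : e c₁ ≠ e c₂ := fun h => hne (heinj _ _ h)
  have b1 := he c₁
  have b2 := he c₂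
  have hn1 : ¬ (x ∈ J ∧ c₁ = P x) := fun h => (hJ h.1).1 h.2
  have hn2 : ¬ (x ∈ J ∧ c₂ = P x) := fun h => (hJ h.1).2 h.2
  simp only [π, hn1, hn2, if_false] at k1 k2
  cases hf : f x <;> cases hf' : f' x <;> simp [hf, hf'] at k1 k2 ⊢ <;> omega

end Graph


section Words
open Classical
set_option linter.unusedSectionVars false

/-- Window of length `m` at position `j`. -/
def win {α : Type} (m : ℕ) (σ : ℕ → α) (j : ℕ) : Fin m → α := fun i => σ (j + i)

/-- The prefix of `σ` of length `k^n+n-1` is de Bruijn of order `n`. -/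
def DB {α : Type} [Fintype α] (n : ℕ) (σ : ℕ → α) : Prop :=
  Set.InjOn (win n σ) (Set.Iio (Fintype.card α ^ n))

/-- Shift map of the de Bruijn graph. -/
def shf {α : Type} (m : ℕ) (x : Fin (m+1) → α) (c : α) : Fin (m+1) → α :=
  Fin.snoc (α := fun _ => α) (Fin.tail x) c

variable {α : Type} [Fintype α]

theorem win_eq_iff (m : ℕ) (σ τ : ℕ → α) (i j : ℕ) :
    win m σ i = win m τ j ↔ ∀ t < m, σ (i + t) = τ (j + t) := by
  constructor
  · intro h t ht
    exact congrFun h ⟨t, ht⟩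
  · intro h
    funext t
    exact h t t.2

theorem shf_eq_iff (m : ℕ) (x y : Fin (m+1) → α) (c : α) :
    shf m x c = y ↔ Fin.tail x = Fin.init y ∧ c = y (Fin.last m) := by
  unfold shf
  constructor
  · rintro rfl
    simp
  · rintro ⟨h1, rfl⟩
    rw [h1]; simp

theorem shf_win (m : ℕ) (σ : ℕ → α) (j : ℕ) :
    shf m (win (m+1) σ j) (σ (j + (m+1))) = win (m+1) σ (j+1) := by
  rw [shf_eq_iff]
  constructor
  · funext i
    simp only [Fin.tail, Fin.init, win, Fin.val_succ, Fin.val_castSucc]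
    congr 1; omega
  · simp only [win, Fin.val_last]
    congr 1; omega

theorem vtx_win (m : ℕ) (σ : ℕ → α) (j : ℕ) :
    vtx (shf m) (win (m+1) σ 0) (fun j => σ (j + (m+1))) j = win (m+1) σ j := by
  induction j with
  | zero => rfl
  | succ j ih =>
    simp only [vtx, ih]
    exact shf_win m σ j

theorem edg_win (m : ℕ) (σ : ℕ → α) (i : ℕ) :
    edg (shf m) (win (m+1) σ 0) (fun j => σ (j + (m+1))) i = (win (m+1) σ i, σ (i + (m+1))) := by
  simp only [edg, vtx_win]

theorem pair_win_iff (m : ℕ) (σ : ℕ → α) (i j : ℕ) :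
    (win (m+1) σ i, σ (i + (m+1))) = (win (m+1) σ j, σ (j + (m+1))) ↔
      win (m+2) σ i = win (m+2) σ j := by
  rw [Prod.mk.injEq, win_eq_iff, win_eq_iff]
  constructor
  · rintro ⟨h1, h2⟩ t ht
    rcases Nat.lt_succ_iff_lt_or_eq.1 ht with h | h
    · exact h1 t h
    · rw [h]; exact h2
  · intro h
    exact ⟨fun t ht => h t (by omega), h _ (by omega)⟩

theorem edg_injOn_iff (m : ℕ) (σ : ℕ → α) (L : ℕ) :
    Set.InjOn (edg (shf m) (win (m+1) σ 0) (fun j => σ (j + (m+1)))) (Set.Iio L) ↔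
    Set.InjOn (win (m+2) σ) (Set.Iio L) := by
  unfold Set.InjOn
  simp only [edg_win, pair_win_iff]

theorem shf_bal (m : ℕ) (y : Fin (m+1) → α) :
    (Finset.univ.filter (fun e : (Fin (m+1) → α) × α => shf m e.1 e.2 = y)).card
      = Fintype.card α := by
  rw [← Finset.card_univ]
  symm
  apply Finset.card_bij (fun a _ => (Fin.cons (α := fun _ => α) a (Fin.init y), y (Fin.last m)))
  · intro a _
    simp [shf_eq_iff]
  · intro a _ b _ h
    have := congrFun (congrArg Prod.fst h) 0
    simpa using this
  · rintro ⟨x, c⟩ h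
    simp only [Finset.mem_filter, Finset.mem_univ, true_and, shf_eq_iff] at h
    refine ⟨x 0, Finset.mem_univ _, ?_⟩
    rw [← h.1, ← h.2, Fin.cons_self_tail]

theorem shf_bal' (m : ℕ) (y : Fin (m+1) → α) :
    (@Finset.filter _ (fun e : (Fin (m+1) → α) × α => shf m e.1 e.2 = y)
      (fun _ => Classical.propDecidable _) Finset.univ).card = Fintype.card α := by
  convert shf_bal m y

theorem card_words (m : ℕ) : Fintype.card (Fin (m+1) → α) * Fintype.card α
    = Fintype.card α ^ (m+2) := by
  simp [pow_succ]

theorem DB_closed (m : ℕ) (σ : ℕ → α) (h : DB (m+2) σ) (t : ℕ) (ht : t < m + 1) :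
    σ (Fintype.card α ^ (m+2) + t) = σ t := by
  have := closed_of_full (shf m) (win (m+1) σ 0) (fun j => σ (j + (m+1))) (shf_bal' m)
    (by rw [edg_injOn_iff, card_words]; exact h)
  rw [vtx_win, card_words, win_eq_iff] at this
  simpa using this t ht

theorem DB_surj (n : ℕ) (σ : ℕ → α) (h : DB n σ) (x : Fin n → α) :
    ∃ j < Fintype.card α ^ n, win n σ j = x := by
  have : (Finset.range (Fintype.card α ^ n)).image (win n σ) = Finset.univ := by
    apply Finset.eq_univ_of_card
    rw [Finset.card_image_of_injOn (by simpa [DB] using h), Finset.card_range]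
    simp
  have hm : x ∈ Finset.univ := Finset.mem_univ x
  rw [← this] at hm
  simpa using hm

/-- glue of a start vertex and labels -/
def glue (m : ℕ) (σ : ℕ → α) (c : ℕ → α) : ℕ → α := fun i => if i < m + 1 then σ i else c (i - (m+1))

theorem glue_win (m : ℕ) (σ c : ℕ → α) : win (m+1) (glue m σ c) 0 = win (m+1) σ 0 := by
  rw [win_eq_iff]
  intro t ht
  simp [glue, ht]

theorem glue_lab (m : ℕ) (σ c : ℕ → α) : (fun j => glue m σ c (j + (m+1))) = c := by
  funext j
  have h : ¬ (j + (m+1) < m + 1) := by omega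
  unfold glue
  rw [if_neg h]; congr 1; omega

theorem glue_agree (m : ℕ) (σ c : ℕ → α) (L : ℕ) (h : ∀ i < L, c i = σ (i + (m+1))) :
    ∀ i < L + (m+1), glue m σ c i = σ i := by
  intro i hi
  unfold glue
  split_ifs with h1
  · rfl
  · rw [h _ (by omega)]; congr 1; omega

theorem glue_inj (m : ℕ) (σ c : ℕ → α)
    (h : Set.InjOn (edg (shf m) (win (m+1) σ 0) c)
      (Set.Iio (Fintype.card (Fin (m+1) → α) * Fintype.card α))) : DB (m+2) (glue m σ c) := by
  unfold DB
  rw [← edg_injOn_iff, glue_win, glue_lab, ← card_words]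
  exact h

/-- One extension step, from a block condition. -/
theorem ext_block (m : ℕ) (σ : ℕ → α) (L : ℕ) (hL : L ≤ Fintype.card α ^ (m+2))
    (hinj : Set.InjOn (win (m+2) σ) (Set.Iio L))
    (hblock : ∀ j < L, ∃ x₁ c₁, Fin.tail x₁ = Fin.tail (win (m+1) σ j) ∧
      (∀ i < L, ¬ (win (m+1) σ i = win (m+1) σ j ∧ σ (i + (m+1)) = c₁)) ∧
      (∀ i < L, ¬ (win (m+1) σ i = x₁ ∧ σ (i + (m+1)) = c₁)) ∧
      (∀ i < L, ¬ (win (m+1) σ i = x₁ ∧ σ (i + (m+1)) = σ (j + (m+1))))) :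
    ∃ τ : ℕ → α, (∀ i < L + (m+1), τ i = σ i) ∧ DB (m+2) τ := by
  obtain ⟨c, hc1, hc2⟩ := euler (shf m) (win (m+1) σ 0) (shf_bal' m) (fun j => σ (j + (m+1))) L
    (by rw [card_words]; exact hL) ((edg_injOn_iff m σ L).2 hinj) (by
      intro Y hs hY
      simp only [edg_win, ne_eq, Prod.mk.injEq] at hY
      have hfull : ∀ x a, x ∈ Y ↔ shf m x a ∈ Y := by
        intro x a
        by_cases hu : ∀ i < L, ¬ (win (m+1) σ i = x ∧ σ (i + (m+1)) = a)
        · exact hY x a hu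
        · push Not at hu
          obtain ⟨j, hj, rfl, rfl⟩ := hu
          obtain ⟨x₁, c₁, ht, h1, h2, h3⟩ := hblock j hj
          have e : ∀ a, shf m x₁ a = shf m (win (m+1) σ j) a := by
            intro a; simp only [shf, ht]
          rw [hY _ _ h1, ← e c₁, ← hY _ _ h2, hY _ _ h3, e]
      intro x
      -- walk from `s` to `x`
      have hwalk : ∀ j, win (m+1) (fun i => if h : i < m + 1 then σ i else
          if h : i - (m+1) < m+1 then x ⟨i - (m+1), h⟩ else σ 0) j ∈ Y := by
        intro j
        induction j with
        | zero =>
          convert hs using 1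
          rw [win_eq_iff]
          intro t ht
          simp [ht]
        | succ j ih =>
          rw [← shf_win, ← hfull]
          exact ih
      have := hwalk (m+1)
      convert this using 1
      funext i
      have h : ¬ (m + 1 + (i:ℕ) < m + 1) := by omega
      have h' : m + 1 + (i:ℕ) - (m+1) = i := by omega
      simp only [win, h, h', dif_neg, i.2, dif_pos, not_false_eq_true])
  refine ⟨glue m σ c, glue_agree m σ c L hc1, glue_inj m σ c hc2⟩

end Words


section Ext
open Classical
set_option linter.unusedSectionVars false
variable {α : Type} [Fintype α]

theorem tail_win (m : ℕ) (σ : ℕ → α) (i : ℕ) : Fin.tail (win (m+1) σ i) = win m σ (i+1) := by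
  funext t
  simp only [Fin.tail, win, Fin.val_succ]
  congr 1; omega

theorem init_win (m : ℕ) (σ : ℕ → α) (i : ℕ) : Fin.init (win (m+1) σ i) = win m σ i := by
  funext t
  simp only [Fin.init, win, Fin.val_castSucc]

theorem win_mono (n m : ℕ) (hnm : n ≤ m) (σ : ℕ → α) (i j : ℕ) (h : win m σ i = win m σ j) :
    win n σ i = win n σ j := by
  rw [win_eq_iff] at *
  exact fun t ht => h t (by omega)

theorem DB_congr (n : ℕ) (σ τ : ℕ → α) (h : ∀ i < Fintype.card α ^ n + n - 1, τ i = σ i)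
    (hσ : DB n σ) : DB n τ := by
  intro i hi j hj hij
  simp only [Set.mem_Iio] at hi hj
  apply hσ hi hj
  rw [win_eq_iff] at *
  intro t ht
  rw [← h _ (by omega), ← h _ (by omega)]
  exact hij t ht

theorem ext_three (n : ℕ) (hn : 1 ≤ n) (hk : 3 ≤ Fintype.card α) (σ : ℕ → α) (hσ : DB n σ) :
    ∃ τ : ℕ → α, (∀ i < Fintype.card α ^ n + n - 1, τ i = σ i) ∧ DB (n+1) τ := by
  obtain ⟨m, rfl⟩ : ∃ m, n = m + 1 := ⟨n - 1, by omega⟩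
  have hpos : 0 < Fintype.card α ^ (m+1) := by positivity
  obtain ⟨τ, h1, h2⟩ := ext_block m σ (Fintype.card α ^ (m+1) - 1)
    (by
      have : Fintype.card α ^ (m+1) ≤ Fintype.card α ^ (m+2) :=
        Nat.pow_le_pow_right (by omega) (by omega)
      omega)
    (by
      intro i hi j hj hij
      simp only [Set.mem_Iio] at hi hj
      apply hσ (by simp only [Set.mem_Iio]; omega) (by simp only [Set.mem_Iio]; omega)
      exact win_mono _ _ (by omega) _ _ _ hij)
    (by
      intro j hj
      obtain ⟨a₁, ha₁⟩ : ∃ a₁, a₁ ≠ win (m+1) σ j 0 :=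
        Fintype.exists_ne_of_one_lt_card (by omega) _
      set x₁ : Fin (m+1) → α := Fin.cons (α := fun _ => α) a₁ (Fin.tail (win (m+1) σ j)) with hx₁
      have hne : x₁ ≠ win (m+1) σ j := by
        intro h
        have := congrFun h 0
        simp [hx₁] at this
        exact ha₁ this
      have htl : Fin.tail x₁ = Fin.tail (win (m+1) σ j) := by simp [hx₁]
      obtain ⟨i₁, hi₁, e₁⟩ := DB_surj (m+1) σ hσ x₁
      obtain ⟨c₁, hc⟩ : ∃ c₁, c₁ ∉ ({σ (j + (m+1)), σ (i₁ + (m+1))} : Finset α) := by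
        by_contra hcon
        push Not at hcon
        have : Finset.univ ⊆ ({σ (j + (m+1)), σ (i₁ + (m+1))} : Finset α) := fun x _ => hcon x
        have h1 := Finset.card_le_card this
        rw [Finset.card_univ] at h1
        have h2 : ({σ (j + (m+1)), σ (i₁ + (m+1))} : Finset α).card ≤ 2 := Finset.card_le_two
        omega
      simp only [Finset.mem_insert, Finset.mem_singleton, not_or] at hc
      refine ⟨x₁, c₁, htl, ?_, ?_, ?_⟩
      · rintro i hi ⟨e, e'⟩
        have : i = j := hσ (by simp only [Set.mem_Iio]; omega) (by simp only [Set.mem_Iio]; omega) e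
        subst this
        exact hc.1 e'.symm
      · rintro i hi ⟨e, e'⟩
        have : i = i₁ := hσ (by simp only [Set.mem_Iio]; omega)
          (by simp only [Set.mem_Iio]; omega) (e.trans e₁.symm)
        subst this
        exact hc.2 e'.symm
      · rintro i hi ⟨e, e'⟩
        have : win (m+1) σ (i+1) = win (m+1) σ (j+1) := by
          rw [← shf_win, ← shf_win, e, e']
          simp only [shf, htl]
        have := hσ (by simp only [Set.mem_Iio]; omega) (by simp only [Set.mem_Iio]; omega) this
        have : i = j := by omega
        subst this
        exact hne e.symm)
  exact ⟨τ, fun i hi => h1 i (by omega), h2⟩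

theorem ext_two (n : ℕ) (hn : 1 ≤ n) (hk : 2 ≤ Fintype.card α) (σ : ℕ → α) (hσ : DB n σ) :
    ∃ τ : ℕ → α, (∀ i < Fintype.card α ^ n + n - 1, τ i = σ i) ∧ DB (n+2) τ := by
  have hpos : 2 ≤ Fintype.card α ^ n := hk.trans (Nat.le_self_pow (by omega) _)
  obtain ⟨τ, h1, h2⟩ := ext_block n σ (Fintype.card α ^ n - 2)
    (by
      have : Fintype.card α ^ n ≤ Fintype.card α ^ (n+2) :=
        Nat.pow_le_pow_right (by omega) (by omega)
      omega)
    (by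
      intro i hi j hj hij
      simp only [Set.mem_Iio] at hi hj
      apply hσ (by simp only [Set.mem_Iio]; omega) (by simp only [Set.mem_Iio]; omega)
      exact win_mono _ _ (by omega) _ _ _ hij)
    (by
      intro j hj
      obtain ⟨a₁, ha₁⟩ : ∃ a₁, a₁ ≠ win (n+1) σ j 0 :=
        Fintype.exists_ne_of_one_lt_card (by omega) _
      set x₁ : Fin (n+1) → α := Fin.cons (α := fun _ => α) a₁ (Fin.tail (win (n+1) σ j)) with hx₁
      have hne : x₁ ≠ win (n+1) σ j := by
        intro h
        have := congrFun h 0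
        simp [hx₁] at this
        exact ha₁ this
      have htl : Fin.tail x₁ = Fin.tail (win (n+1) σ j) := by simp [hx₁]
      obtain ⟨c₁, hc⟩ : ∃ c₁, c₁ ≠ σ (j + (n+1)) :=
        Fintype.exists_ne_of_one_lt_card (by omega) _
      have key : ∀ i < Fintype.card α ^ n - 2,
          Fin.tail (win (n+1) σ i) = Fin.tail (win (n+1) σ j) → i = j := by
        intro i hi h
        rw [tail_win, tail_win] at h
        have := hσ (by simp only [Set.mem_Iio]; omega) (by simp only [Set.mem_Iio]; omega) h
        omega
      refine ⟨x₁, c₁, htl, ?_, ?_, ?_⟩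
      · rintro i hi ⟨e, e'⟩
        have := key i hi (by rw [e])
        subst this
        exact hc e'.symm
      · rintro i hi ⟨e, e'⟩
        have := key i hi (by rw [e, htl])
        subst this
        exact hne e.symm
      · rintro i hi ⟨e, e'⟩
        have := key i hi (by rw [e, htl])
        subst this
        exact hne e.symm)
  exact ⟨τ, fun i hi => h1 i (by omega), h2⟩

theorem periodize (m : ℕ) (hm : 1 ≤ m) (W : ℕ → α) (hW : DB (m+1) W) :
    ∃ W' : ℕ → α, (∀ i < Fintype.card α ^ (m+1) + (m+1) - 1, W' i = W i) ∧
      win (m+1) W' (Fintype.card α ^ (m+1)) = win (m+1) W' 0 := by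
  obtain ⟨r, rfl⟩ : ∃ r, m = r + 1 := ⟨m - 1, by omega⟩
  have hpos : 0 < Fintype.card α ^ (r+1+1) := by
    have : Nonempty α := ⟨W 0⟩
    have := Fintype.card_pos (α := α)
    positivity
  refine ⟨Function.update W (Fintype.card α ^ (r+1+1) + (r+1)) (W (r+1)), ?_, ?_⟩
  · intro i hi
    exact Function.update_of_ne (by omega) _ _
  · rw [win_eq_iff]
    intro t ht
    rw [zero_add]
    rw [Function.update_of_ne (a := t) (by omega)]
    by_cases h : t = r + 1
    · rw [h, Function.update_self]
    · rw [Function.update_of_ne (by omega)]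
      exact DB_closed r W hW t (by omega)

theorem setup (m n : ℕ) (hn : n ≤ m) (W : ℕ → α) (hW : DB (m+1) W) (hWn : DB n W)
    (hper : win (m+1) W (Fintype.card α ^ (m+1)) = win (m+1) W 0) (L : ℕ)
    (hL : L = Fintype.card α ^ n + n - 1 - (m+1)) :
    ∃ (pos : (Fin (m+1) → α) → ℕ) (h : (Fin (m+1) → α) → ℕ),
      (∀ x, pos x < Fintype.card α ^ (m+1)) ∧ (∀ x, win (m+1) W (pos x) = x) ∧
      (∀ j < Fintype.card α ^ (m+1), pos (win (m+1) W j) = j) ∧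
      (∀ x i, x ≠ win (m+1) W 0 → pos x < i → i ≤ Fintype.card α ^ (m+1) →
        h (win (m+1) W i) < h x) ∧
      (∀ i j, 1 ≤ i → 1 ≤ j → i ≤ Fintype.card α ^ (m+1) → j ≤ Fintype.card α ^ (m+1) →
        win (m+1) W i = win (m+1) W j → i = j) ∧
      (∀ x, L ≤ pos x → ∀ c, ∀ j < L,
        edg (shf m) (win (m+1) W 0) (fun j => W (j + (m+1))) j ≠ (x, c)) ∧
      (∀ x, pos x < L → ∀ c, c ≠ W (pos x + (m+1)) → (∀ j < L,
        edg (shf m) (win (m+1) W 0) (fun j => W (j + (m+1))) j ≠ (x, c)) ∧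
        (x ≠ win (m+1) W 0 → h (shf m x c) < h x)) := by
  set K := Fintype.card α ^ (m+1) with hK
  have : Nonempty α := ⟨W 0⟩
  have hcp := Fintype.card_pos (α := α)
  have hKn : Fintype.card α ^ n ≤ K := Nat.pow_le_pow_right hcp (by omega)
  have hpn : 0 < Fintype.card α ^ n := by positivity
  have hLK : L ≤ K := by omega
  choose pos hp1 hp2 using DB_surj (m+1) W hW
  have hp3 : ∀ j < K, pos (win (m+1) W j) = j := fun j hj => hW (hp1 _) hj (hp2 _)
  let h : (Fin (m+1) → α) → ℕ := fun x => if x = win (m+1) W 0 then 0 else K - pos x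
  have hfwd : ∀ x i, x ≠ win (m+1) W 0 → pos x < i → i ≤ K → h (win (m+1) W i) < h x := by
    intro x i hx hi hiK
    have hx' := hp1 x
    rw [← hK] at hx'
    simp only [h, if_neg hx]
    by_cases hi0 : win (m+1) W i = win (m+1) W 0
    · rw [if_pos hi0]; omega
    · rw [if_neg hi0]
      have : i ≠ K := fun e => hi0 (by rw [e]; exact hper)
      rw [hp3 i (by omega)]
      omega
  refine ⟨pos, h, hp1, hp2, hp3, hfwd, ?_, ?_, ?_⟩
  · intro i j hi hj hiK hjK hij
    rcases hiK.lt_or_eq with h1 | h1 <;> rcases hjK.lt_or_eq with h2 | h2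
    · exact hW h1 h2 hij
    · rw [h2, hper] at hij
      have := hW h1 (show (0:ℕ) < _ by omega) hij
      omega
    · rw [h1, hper] at hij
      have := hW (show (0:ℕ) < _ by omega) h2 hij
      omega
    · omega
  · intro x hx c j hj he
    rw [edg_win, Prod.mk.injEq] at he
    have := hp3 j (by omega)
    rw [he.1] at this
    omega
  · intro x hx c hc
    constructor
    · intro j hj he
      rw [edg_win, Prod.mk.injEq] at he
      have := hp3 j (by omega)
      rw [he.1] at this
      rw [this] at hc
      exact hc he.2.symm
    · intro hxs
      set y := shf m x c with hy
      have hy' := (shf_eq_iff m x y c).1 rfl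
      by_cases hpy : pos x < pos y
      · have := hfwd x (pos y) hxs hpy (hp1 y).le
        rwa [hp2] at this
      · exfalso
        have e1 : win m W (pos x + 1) = win m W (pos y) := by
          rw [← tail_win, hp2, hy'.1, ← init_win, hp2]
        have e2 := win_mono n m hn W _ _ e1
        have e3 := hWn (by simp only [Set.mem_Iio]; omega) (by simp only [Set.mem_Iio]; omega) e2
        omega

theorem many_words (m : ℕ) (W : ℕ → α) (L : ℕ) (hL : L ≤ Fintype.card α ^ (m+1))
    (hW : DB (m+1) W) (N : ℕ) (h : (Fin (m+1) → α) → ℕ) (P : (Fin (m+1) → α) → α)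
    (I : Finset (Fin (m+1) → α)) (hI : N ≤ I.card) (J : Set (Fin (m+1) → α))
    (H1 : ∀ x, x ≠ win (m+1) W 0 → x ∈ J → (∀ j < L,
      edg (shf m) (win (m+1) W 0) (fun j => W (j + (m+1))) j ≠ (x, P x)) ∧
      h (shf m x (P x)) < h x)
    (H2 : ∀ x, x ≠ win (m+1) W 0 → x ∉ J → ∀ a, (∀ j < L,
      edg (shf m) (win (m+1) W 0) (fun j => W (j + (m+1))) j ≠ (x, a)) ∧ h (shf m x a) < h x)
    (H3 : ∀ x, x ∈ I → ∃ c₁ c₂, c₁ ≠ c₂ ∧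
      (∀ j < L, edg (shf m) (win (m+1) W 0) (fun j => W (j + (m+1))) j ≠ (x, c₁)) ∧
      (∀ j < L, edg (shf m) (win (m+1) W 0) (fun j => W (j + (m+1))) j ≠ (x, c₂)) ∧
      (x ∈ J → c₁ ≠ P x ∧ c₂ ≠ P x)) :
    ∃ G : (Fin N → Bool) → ℕ → α, (∀ f, ∀ i < L + (m+1), G f i = W i) ∧ (∀ f, DB (m+2) (G f)) ∧
      ∀ f f', (∀ i < Fintype.card α ^ (m+2) + (m+1), G f i = G f' i) → f = f' := by
  have : Nonempty α := ⟨W 0⟩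
  have hcp := Fintype.card_pos (α := α)
  obtain ⟨E, hE1, hE2, hE3⟩ := many (shf m) (win (m+1) W 0) (shf_bal' m)
    (fun j => W (j + (m+1))) L
    (by rw [card_words]; exact hL.trans (Nat.pow_le_pow_right hcp (by omega)))
    ((edg_injOn_iff m W L).2 (by
      intro i hi j hj hij
      simp only [Set.mem_Iio] at hi hj
      apply hW (by simp only [Set.mem_Iio]; omega) (by simp only [Set.mem_Iio]; omega)
      exact win_mono _ _ (by omega) _ _ _ hij)) h P (I : Set _) J H1 H2 H3
  obtain ⟨ι⟩ : Nonempty (Fin N ↪ I) := by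
    apply Function.Embedding.nonempty_of_card_le
    simpa using hI
  let ι' : Fin N → (Fin (m+1) → α) := fun i => (ι i : Fin (m+1) → α)
  have hι : Function.Injective ι' := fun a b hab => ι.injective (Subtype.ext hab)
  refine ⟨fun f => glue m W (E (Function.extend ι' f (fun _ => false))), ?_, ?_, ?_⟩
  · intro f
    exact glue_agree m W _ L (hE1 _)
  · intro f
    exact glue_inj m W _ (hE2 _)
  · intro f f' hff
    funext i
    have := hE3 (Function.extend ι' f (fun _ => false)) (Function.extend ι' f' (fun _ => false)) (by
      intro j hj
      have e1 := congrFun (glue_lab m W (E (Function.extend ι' f (fun _ => false)))) j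
      have e2 := congrFun (glue_lab m W (E (Function.extend ι' f' (fun _ => false)))) j
      rw [← e1, ← e2]
      apply hff
      rw [card_words] at hj
      omega) (ι' i) (ι i).2
    rwa [hι.extend_apply, hι.extend_apply] at this

theorem many_three (hk : Fintype.card α = 3) (n : ℕ) (hn : 1 ≤ n) (σ : ℕ → α) (hσ : DB n σ) :
    ∃ G : (Fin (2 * 3^n) → Bool) → ℕ → α,
      (∀ f, ∀ i < Fintype.card α ^ n + n - 1, G f i = σ i) ∧ (∀ f, DB (n+2) (G f)) ∧
      ∀ f f', (∀ i < Fintype.card α ^ (n+2) + (n+2) - 1, G f i = G f' i) → f = f' := by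
  obtain ⟨W₀, hW₀, hW₀'⟩ := ext_three n hn (by omega) σ hσ
  obtain ⟨W, hWa, hper⟩ := periodize n hn W₀ hW₀'
  have hKn : Fintype.card α ^ n ≤ Fintype.card α ^ (n+1) :=
    Nat.pow_le_pow_right (by omega) (by omega)
  have hW : DB (n+1) W := DB_congr _ _ _ hWa hW₀'
  have hWσ : ∀ i < Fintype.card α ^ n + n - 1, W i = σ i := fun i hi => by
    rw [hWa i (by omega), hW₀ i hi]
  have hWn : DB n W := DB_congr _ _ _ hWσ hσ
  obtain ⟨pos, h, hp1, hp2, hp3, hfwd, hinj, hhi, hlo⟩ := setup n n le_rfl W hW hWn hper _ rfl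
  have hoth : ∀ a : α, ∃ b, b ≠ a := fun a => Fintype.exists_ne_of_one_lt_card (by omega) _
  choose oth hoth using hoth
  set L := Fintype.card α ^ n + n - 1 - (n+1) with hL
  obtain ⟨G, hG1, hG2, hG3⟩ := many_words n W L (by omega) hW (2 * 3^n) h
    (fun x => if pos x < L then oth (W (pos x + (n+1))) else W (pos x + (n+1)))
    ((Finset.Ico L (Fintype.card α ^ (n+1))).image (win (n+1) W)) (by
      rw [Finset.card_image_of_injOn]
      · rw [Nat.card_Ico, hL, hk, pow_succ]; omega
      · intro i hi j hj
        simp only [Finset.coe_Ico, Set.mem_Ico] at hi hj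
        exact hW hi.2 hj.2) Set.univ (by
      intro x hx _
      split_ifs with hlt
      · obtain ⟨h1, h2⟩ := hlo x hlt _ (hoth _)
        exact ⟨h1, h2 hx⟩
      · refine ⟨hhi x (by omega) _, ?_⟩
        have e : shf n x (W (pos x + (n+1))) = win (n+1) W (pos x + 1) := by
          rw [← shf_win, hp2]
        rw [e]
        exact hfwd x _ hx (by omega) (hp1 x)) (by
      intro x _ hx
      exact absurd (Set.mem_univ x) hx) (by
      intro x hx
      simp only [Finset.mem_image, Finset.mem_Ico] at hx
      obtain ⟨j, hj, rfl⟩ := hx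
      rw [hp3 j hj.2]
      have hc : 1 < (Finset.univ.erase (W (j + (n+1)))).card := by
        rw [Finset.card_erase_of_mem (Finset.mem_univ _), Finset.card_univ, hk]; norm_num
      obtain ⟨c₁, h1, c₂, h2, hne⟩ := Finset.one_lt_card.1 hc
      have hhi' := hhi (win (n+1) W j) (by rw [hp3 j hj.2]; exact hj.1)
      refine ⟨c₁, c₂, hne, hhi' c₁, hhi' c₂, fun _ => ?_⟩
      rw [if_neg (by omega)]
      exact ⟨Finset.ne_of_mem_erase h1, Finset.ne_of_mem_erase h2⟩)
  refine ⟨G, fun f i hi => ?_, hG2, fun f f' hff => hG3 f f' (fun i hi => hff i (by omega))⟩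
  rw [hG1 f i (by omega), hWσ i hi]

theorem many_two (hk : Fintype.card α = 2) (n : ℕ) (hn : 1 ≤ n) (σ : ℕ → α) (hσ : DB n σ) :
    ∃ G : (Fin (2^n) → Bool) → ℕ → α,
      (∀ f, ∀ i < Fintype.card α ^ n + n - 1, G f i = σ i) ∧ (∀ f, DB (n+3) (G f)) ∧
      ∀ f f', (∀ i < Fintype.card α ^ (n+3) + (n+3) - 1, G f i = G f' i) → f = f' := by
  obtain ⟨W₀, hW₀, hW₀'⟩ := ext_two n hn (by omega) σ hσ
  obtain ⟨W, hWa, hper⟩ := periodize (n+1) (by omega) W₀ hW₀'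
  have hKn : Fintype.card α ^ n ≤ Fintype.card α ^ (n+1+1) :=
    Nat.pow_le_pow_right (by omega) (by omega)
  have hW : DB (n+1+1) W := DB_congr _ _ _ hWa hW₀'
  have hWσ : ∀ i < Fintype.card α ^ n + n - 1, W i = σ i := fun i hi => by
    rw [hWa i (by omega), hW₀ i hi]
  have hWn : DB n W := DB_congr _ _ _ hWσ hσ
  obtain ⟨pos, h, hp1, hp2, hp3, hfwd, hinj, hhi, hlo⟩ :=
    setup (n+1) n (by omega) W hW hWn hper _ rfl
  have hoth : ∀ a : α, ∃ b, b ≠ a := fun a => Fintype.exists_ne_of_one_lt_card (by omega) _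
  choose oth hoth using hoth
  have htwo : ∀ a b c : α, a ≠ b → c ≠ a → c = b := by
    intro a b c hab hca
    by_contra hcb
    have : ({a, b, c} : Finset α).card ≤ 2 := by
      rw [← hk]; exact Finset.card_le_univ _
    rw [Finset.card_eq_three.2 ⟨a, b, c, hab, fun h => hca h.symm, fun h => hcb h.symm, rfl⟩] at this
    omega
  have hinv : ∀ a, oth (oth a) = a := fun a => htwo _ _ _ (hoth a) (hoth _)
  set L := Fintype.card α ^ n + n - 1 - (n+1+1) with hL
  let cj : (Fin (n+1+1) → α) → (Fin (n+1+1) → α) := fun x =>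
    Fin.cons (α := fun _ => α) (oth (x 0)) (Fin.tail x)
  have hcj : ∀ x, cj (cj x) = x := by
    intro x
    simp [cj, hinv]
  have hcjt : ∀ x, Fin.tail (cj x) = Fin.tail x := fun x => by simp [cj]
  have hcjne : ∀ x, cj x ≠ x := by
    intro x hx
    have := congrFun hx 0
    simp [cj, hoth] at this
  have hpne : ∀ x, pos (cj x) ≠ pos x := by
    intro x hx
    apply hcjne x
    rw [← hp2 (cj x), hx, hp2]
  let T : Finset (Fin (n+1+1) → α) := Finset.univ.filter (fun x => pos x < pos (cj x))
  have hT : 2^(n+1) ≤ T.card := by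
    have hU : (Finset.univ : Finset (Fin (n+1+1) → α)) ⊆ T ∪ T.image cj := by
      intro x _
      rw [Finset.mem_union]
      by_cases hx : pos x < pos (cj x)
      · left; simp [T, hx]
      · right
        refine Finset.mem_image.2 ⟨cj x, ?_, hcj x⟩
        have := hpne x
        simp only [T, Finset.mem_filter, Finset.mem_univ, true_and, hcj]
        omega
    have h1 := Finset.card_le_card hU
    have h2 := Finset.card_union_le T (T.image cj)
    have h3 : (T.image cj).card ≤ T.card := Finset.card_image_le
    have h4 : (Finset.univ : Finset (Fin (n+1+1) → α)).card = 2^(n+1) * 2 := by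
      rw [Finset.card_univ]; simp [hk, pow_succ]
    omega
  have hshf : ∀ x, shf (n+1) x (W (pos x + (n+1+1))) = win (n+1+1) W (pos x + 1) := by
    intro x
    rw [← shf_win, hp2]
  let I : Finset (Fin (n+1+1) → α) := T \ (Finset.range L).image (win (n+1+1) W)
  have hImem : ∀ x, x ∈ I ↔ pos x < pos (cj x) ∧ L ≤ pos x := by
    intro x
    simp only [I, T, Finset.mem_sdiff, Finset.mem_filter, Finset.mem_univ, true_and,
      Finset.mem_image, Finset.mem_range, not_exists, not_and]
    refine and_congr_right fun _ => ⟨fun hh => ?_, fun hh j hj e => ?_⟩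
    · by_contra hcon
      exact hh (pos x) (by omega) (hp2 x)
    · rw [← e, hp3 j (by omega)] at hh
      omega
  obtain ⟨G, hG1, hG2, hG3⟩ := many_words (n+1) W L (by omega) hW (2^n) h
    (fun x => if pos x < L then oth (W (pos x + (n+1+1))) else W (pos x + (n+1+1)))
    I (by
      have h1 := Finset.le_card_sdiff ((Finset.range L).image (win (n+1+1) W)) T
      have h2 : ((Finset.range L).image (win (n+1+1) W)).card ≤ L := by
        simpa using Finset.card_image_le (s := Finset.range L) (f := win (n+1+1) W)
      have h3 : L ≤ 2^n := by
        have : 0 < 2^n := by positivity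
        rw [hL, hk]; omega
      have h4 : 2^(n+1) = 2^n * 2 := pow_succ _ _
      show 2^n ≤ (T \ (Finset.range L).image (win (n+1+1) W)).card
      omega) {x | x ∉ I} (by
      intro x hx _
      split_ifs with hlt
      · obtain ⟨h1, h2⟩ := hlo x hlt _ (hoth _)
        exact ⟨h1, h2 hx⟩
      · refine ⟨hhi x (by omega) _, ?_⟩
        rw [hshf]
        exact hfwd x _ hx (by omega) (hp1 x)) (by
      intro x hxs hx a
      simp only [Set.mem_ofPred_eq, not_not, hImem] at hx
      refine ⟨hhi x hx.2 _, ?_⟩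
      by_cases ha : a = W (pos x + (n+1+1))
      · rw [ha, hshf]
        exact hfwd x _ hxs (by omega) (hp1 x)
      · have hqne : W (pos x + (n+1+1)) ≠ W (pos (cj x) + (n+1+1)) := by
          intro heq
          have e1 := hshf x
          have e2 := hshf (cj x)
          rw [← heq] at e2
          have e3 : shf (n+1) (cj x) (W (pos x + (n+1+1))) = shf (n+1) x (W (pos x + (n+1+1))) := by
            simp only [shf, hcjt]
          rw [e2, e1] at e3
          have := hinj _ _ (by omega) (by omega) (hp1 _) (hp1 _) e3
          exact hpne x (by omega)
        have ha' : a = W (pos (cj x) + (n+1+1)) := htwo _ _ _ hqne ha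
        have e : shf (n+1) x a = win (n+1+1) W (pos (cj x) + 1) := by
          rw [← hshf, ← ha']
          simp only [shf, hcjt]
        rw [e]
        exact hfwd x _ hxs (by omega) (hp1 _)) (by
      intro x hx
      have hx' := (hImem x).1 hx
      refine ⟨W 0, oth (W 0), (hoth _).symm, hhi x hx'.2 _, hhi x hx'.2 _, fun hh => ?_⟩
      exact absurd hx hh)
  refine ⟨G, fun f i hi => ?_, hG2, fun f f' hff => hG3 f f' (fun i hi => hff i (by
    have : Fintype.card α ^ (n+1+2) = Fintype.card α ^ (n+3) := rfl
    omega))⟩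
  rw [hG1 f i (by omega), hWσ i hi]

end Ext


section Frostman
open MeasureTheory Filter Topology
open scoped ENNReal NNReal

/-- Integer formed by the first `L` digits. -/
def wint (b : ℕ) (x : ℕ → Fin b) : ℕ → ℕ
  | 0 => 0
  | L + 1 => b * wint b x L + x L

theorem wint_inj (b : ℕ) (x y : ℕ → Fin b) (L : ℕ) (h : wint b x L = wint b y L) :
    ∀ i < L, x i = y i := by
  induction L with
  | zero => intro i hi; omega
  | succ L ih =>
    simp only [wint] at h
    have h1 : (x L : ℕ) = y L := by
      have := congrArg (· % b) h
      simpa [Nat.mul_add_mod, Nat.mod_eq_of_lt (x L).2, Nat.mod_eq_of_lt (y L).2] using this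
    have hb : 0 < b := Fin.pos (x 0)
    have h2 : wint b x L = wint b y L := by
      rw [h1] at h
      exact Nat.eq_of_mul_eq_mul_left hb (by omega)
    intro i hi
    rcases Nat.lt_succ_iff_lt_or_eq.mp hi with h3 | rfl
    · exact ih h2 i h3
    · exact Fin.ext h1

theorem wint_sum (b : ℕ) (x : ℕ → Fin b) (L : ℕ) :
    (b:ℝ) ^ L * ∑ i ∈ Finset.range L, Real.ofDigitsTerm x i = wint b x L := by
  have hb : 0 < b := Fin.pos (x 0)
  induction L with
  | zero => simp [wint]
  | succ L ih =>
    rw [Finset.sum_range_succ, mul_add, pow_succ', mul_assoc, ih, Real.ofDigitsTerm, wint]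
    push_cast
    congr 1
    rw [← pow_succ', mul_comm, mul_assoc, inv_mul_cancel₀ (by positivity), mul_one]

theorem wint_bound (b : ℕ) (x : ℕ → Fin b) (L : ℕ) :
    (wint b x L : ℝ) ≤ b ^ L * Real.ofDigits x ∧ b ^ L * Real.ofDigits x ≤ wint b x L + 1 := by
  have hb : 0 < b := Fin.pos (x 0)
  rw [Real.ofDigits_eq_sum_add_ofDigits x L, mul_add, wint_sum, ← mul_assoc,
    mul_inv_cancel₀ (by positivity), one_mul]
  have h1 := Real.ofDigits_nonneg (fun i => x (i + L))
  have h2 := Real.ofDigits_le_one (fun i => x (i + L))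
  constructor <;> linarith

theorem digit_class_measure {Ω : Type} [MeasurableSpace Ω] (P : Measure Ω) (b : ℕ)
    (x : Ω → ℕ → Fin b) (M : ℝ≥0∞) (L : ℕ)
    (hM : ∀ u : ℕ → Fin b, P {d | ∀ i < L, x d i = u i} ≤ M) (s : Set ℝ)
    (hs : ∀ p ∈ s, ∀ q ∈ s, (b:ℝ) ^ L * |p - q| ≤ 1) :
    P ((fun d => Real.ofDigits (x d)) ⁻¹' s) ≤ 5 * M := by
  rcases Set.eq_empty_or_nonempty ((fun d => Real.ofDigits (x d)) ⁻¹' s) with h | ⟨d0, hd0⟩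
  · rw [h]; simp
  have hsub : (fun d => Real.ofDigits (x d)) ⁻¹' s ⊆
      ⋃ n ∈ Finset.range 5, {d | wint b (x d) L + 2 = wint b (x d0) L + n} := by
    intro d hd
    have h1 := hs _ hd _ hd0
    have h2 := wint_bound b (x d) L
    have h3 := wint_bound b (x d0) L
    have h4 : |(b:ℝ) ^ L * Real.ofDigits (x d) - b ^ L * Real.ofDigits (x d0)| ≤ 1 := by
      rw [← mul_sub, abs_mul, abs_of_nonneg (by positivity)]; exact h1
    rw [abs_le] at h4
    have h5 : (wint b (x d) L : ℝ) ≤ wint b (x d0) L + 2 := by linarith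
    have h6 : (wint b (x d0) L : ℝ) ≤ wint b (x d) L + 2 := by linarith
    norm_cast at h5 h6
    simp only [Set.mem_iUnion, Finset.mem_range, Set.mem_setOf_eq, exists_prop]
    exact ⟨wint b (x d) L + 2 - wint b (x d0) L, by omega, by omega⟩
  refine (measure_mono hsub).trans ((measure_biUnion_finset_le _ _).trans ?_)
  have : ∀ n ∈ Finset.range 5, P {d | wint b (x d) L + 2 = wint b (x d0) L + n} ≤ M := by
    intro n _
    rcases Set.eq_empty_or_nonempty {d | wint b (x d) L + 2 = wint b (x d0) L + n} with h | ⟨d1, hd1⟩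
    · rw [h]; simp
    refine le_trans (measure_mono ?_) (hM (x d1))
    intro d hd
    simp only [Set.mem_setOf_eq] at hd hd1 ⊢
    exact wint_inj b _ _ L (by omega)
  refine (Finset.sum_le_card_nsmul _ _ _ this).trans ?_
  simp

theorem frostman {Ω : Type} [MeasurableSpace Ω] (P : Measure Ω) [IsProbabilityMeasure P] (b : ℕ)
    (hb : 2 ≤ b) (x : Ω → ℕ → Fin b) (hx : ∀ i, Measurable (fun d => x d i))
    (t : ℝ) (ht : 0 < t) (K : ℝ) (hK : 0 < K)
    (hM : ∀ (L : ℕ) (u : ℕ → Fin b),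
      P {d | ∀ i < L, x d i = u i} ≤ ENNReal.ofReal (K * ((b:ℝ)⁻¹ ^ L) ^ t))
    (S : Set ℝ) (hS : ∀ d, Real.ofDigits (x d) ∈ S) : ENNReal.ofReal t ≤ dimH S := by
  have hb0 : (0:ℝ) < b := by positivity
  have hb1 : (1:ℝ) < b := by exact_mod_cast (by omega : 1 < b)
  have hbi : (b:ℝ)⁻¹ < 1 := inv_lt_one_of_one_lt₀ hb1
  have hbi0 : 0 < (b:ℝ)⁻¹ := by positivity
  set φ : Ω → ℝ := fun d => Real.ofDigits (x d) with hφ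
  have hmeas : Measurable φ := by
    have : Measurable x := measurable_pi_iff.mpr hx
    exact Real.continuous_ofDigits.measurable.comp this
  set K' : ℝ := 5 * K * (b:ℝ) ^ t with hK'
  have hK'0 : 0 < K' := by positivity
  -- bound for closed sets
  have key : ∀ s : Set ℝ, Metric.ediam s ≤ 1 → P (φ ⁻¹' s) ≤ ENNReal.ofReal K' * Metric.ediam s ^ t := by
    intro s hs
    have hne : Metric.ediam s ≠ ∞ := ne_top_of_le_ne_top ENNReal.one_ne_top hs
    have hD : ∀ p ∈ s, ∀ q ∈ s, |p - q| ≤ (Metric.ediam s).toReal := by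
      intro p hp q hq
      have := Metric.edist_le_ediam_of_mem hp hq
      rw [edist_dist] at this
      rw [← Real.dist_eq]
      exact (ENNReal.ofReal_le_iff_le_toReal hne).mp this
    set D := (Metric.ediam s).toReal with hDdef
    have hD0 : 0 ≤ D := ENNReal.toReal_nonneg
    have hD1 : D ≤ 1 := by
      have := ENNReal.toReal_mono ENNReal.one_ne_top hs
      simpa using this
    have hgen : ∀ L : ℕ, D ≤ (b:ℝ)⁻¹ ^ L → P (φ ⁻¹' s) ≤ ENNReal.ofReal (5 * K * ((b:ℝ)⁻¹ ^ L) ^ t) := by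
      intro L hL
      have := digit_class_measure P b x _ L (hM L) s (by
        intro p hp q hq
        calc (b:ℝ) ^ L * |p - q| ≤ (b:ℝ) ^ L * (b:ℝ)⁻¹ ^ L := by
              gcongr; exact (hD p hp q hq).trans hL
          _ = 1 := by rw [← mul_pow, mul_inv_cancel₀ hb0.ne', one_pow])
      refine this.trans (le_of_eq ?_)
      rw [mul_assoc, ENNReal.ofReal_mul (by norm_num : (0:ℝ) ≤ 5)]
      norm_num
    have hed : Metric.ediam s = ENNReal.ofReal D := (ENNReal.ofReal_toReal hne).symm
    rcases hD0.eq_or_lt with h0 | h0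
    · -- diameter zero
      have hlim : Tendsto (fun L : ℕ => ENNReal.ofReal (5 * K * ((b:ℝ)⁻¹ ^ L) ^ t)) atTop (𝓝 (ENNReal.ofReal (5 * K * (0:ℝ) ^ t))) := by
        apply ENNReal.tendsto_ofReal
        apply Tendsto.const_mul
        have h1 := tendsto_pow_atTop_nhds_zero_of_lt_one hbi0.le hbi
        exact h1.rpow_const (Or.inr ht.le)
      have h2 := ge_of_tendsto' hlim (fun L => hgen L (by rw [← h0]; positivity))
      rw [Real.zero_rpow ht.ne', mul_zero, ENNReal.ofReal_zero] at h2
      exact h2.trans zero_le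
    · obtain ⟨L, hL1, hL2⟩ := exists_nat_pow_near_of_lt_one h0 hD1 hbi0 hbi
      refine (hgen L hL2).trans ?_
      rw [hed, ENNReal.ofReal_rpow_of_pos h0, ← ENNReal.ofReal_mul hK'0.le]
      apply ENNReal.ofReal_le_ofReal
      rw [hK', mul_assoc (5 * K), ← Real.mul_rpow hb0.le hD0]
      gcongr
      rw [pow_succ] at hL1
      have := mul_le_mul_of_nonneg_left hL1.le hb0.le
      calc (b:ℝ)⁻¹ ^ L = b * ((b:ℝ)⁻¹ ^ L * (b:ℝ)⁻¹) := by field_simp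
        _ ≤ _ := this
  set c : ℝ≥0∞ := (ENNReal.ofReal K')⁻¹ with hc
  have hKne : ENNReal.ofReal K' ≠ 0 := by simpa using hK'0
  have hle : c • P.map φ ≤ Measure.hausdorffMeasure (X := ℝ) t := by
    apply Measure.le_hausdorffMeasure t _ 1 one_pos
    intro s hs
    have h1 : Metric.ediam (closure s) = Metric.ediam s := Metric.ediam_closure s
    have h2 : P.map φ s ≤ ENNReal.ofReal K' * Metric.ediam s ^ t := by
      calc P.map φ s ≤ P.map φ (closure s) := measure_mono subset_closure
        _ = P (φ ⁻¹' closure s) := Measure.map_apply hmeas isClosed_closure.measurableSet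
        _ ≤ _ := by
          have := key (closure s) (h1 ▸ hs)
          rwa [h1] at this
    rw [Measure.smul_apply, smul_eq_mul]
    calc c * P.map φ s ≤ c * (ENNReal.ofReal K' * Metric.ediam s ^ t) := by gcongr
      _ = _ := by rw [← mul_assoc, hc, ENNReal.inv_mul_cancel hKne ENNReal.ofReal_ne_top, one_mul]
  have hpos : Measure.hausdorffMeasure (X := ℝ) t S ≠ 0 := by
    intro h0
    have h1 := Measure.le_iff'.mp hle S
    rw [h0, Measure.smul_apply, smul_eq_mul] at h1
    have h2 := Measure.le_map_apply hmeas.aemeasurable S (μ := P)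
    have h3 : φ ⁻¹' S = Set.univ := Set.eq_univ_of_forall hS
    rw [h3, measure_univ] at h2
    have h4 : c * P.map φ S = 0 := le_antisymm h1 zero_le
    rcases mul_eq_zero.mp h4 with h | h
    · simp [hc] at h
    · rw [h] at h2; simp at h2
  have := le_dimH_of_hausdorffMeasure_ne_zero (d := t.toNNReal) (s := S) (by
    rwa [Real.coe_toNNReal t ht.le])
  exact this

end Frostman


section Tree
open MeasureTheory Filter Topology
open scoped ENNReal NNReal

variable {α : Type} {N : ℕ → ℕ} {Q : ℕ → (ℕ → α) → Prop}

/-- The stage-`j` sequence obtained from the choices `d`. -/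
def stg (G : ∀ j, {σ : ℕ → α // Q j σ} → (Fin (N j) → Bool) → {σ : ℕ → α // Q (j+1) σ})
    (σ0 : {σ : ℕ → α // Q 0 σ}) (d : ∀ j, Fin (N j) → Bool) : ∀ j, {σ : ℕ → α // Q j σ}
  | 0 => σ0
  | j + 1 => G j (stg G σ0 d j) (d j)

variable (G : ∀ j, {σ : ℕ → α // Q j σ} → (Fin (N j) → Bool) → {σ : ℕ → α // Q (j+1) σ})
    (σ0 : {σ : ℕ → α // Q 0 σ}) (ℓ : ℕ → ℕ)

theorem stg_det (d d' : ∀ j, Fin (N j) → Bool) (j : ℕ) (h : ∀ i < j, d i = d' i) :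
    stg G σ0 d j = stg G σ0 d' j := by
  induction j with
  | zero => rfl
  | succ j ih =>
    simp only [stg]
    rw [ih (fun i hi => h i (by omega)), h j (by omega)]

theorem stg_stable (hℓ : Monotone ℓ)
    (hG : ∀ j σ f, ∀ i < ℓ j, (G j σ f).1 i = σ.1 i)
    (d : ∀ j, Fin (N j) → Bool) (j j' : ℕ) (hj : j ≤ j') (i : ℕ) (hi : i < ℓ j) :
    (stg G σ0 d j').1 i = (stg G σ0 d j).1 i := by
  induction j', hj using Nat.le_induction with
  | base => rfl
  | succ n hn ih =>
    rw [← ih]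
    exact hG n _ _ i (lt_of_lt_of_le hi (hℓ hn))

theorem stg_inj (hℓ : Monotone ℓ)
    (hG : ∀ j σ f, ∀ i < ℓ j, (G j σ f).1 i = σ.1 i)
    (hG2 : ∀ j σ f f', (∀ i < ℓ (j+1), (G j σ f).1 i = (G j σ f').1 i) → f = f')
    (d d' : ∀ j, Fin (N j) → Bool) (j : ℕ)
    (h : ∀ i < ℓ j, (stg G σ0 d j).1 i = (stg G σ0 d' j).1 i) : ∀ i < j, d i = d' i := by
  induction j with
  | zero => intro i hi; omega
  | succ j ih =>
    have h1 : ∀ i < j, d i = d' i := by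
      apply ih
      intro i hi
      rw [← stg_stable G σ0 ℓ hℓ hG d j (j+1) (by omega) i hi,
        ← stg_stable G σ0 ℓ hℓ hG d' j (j+1) (by omega) i hi]
      exact h i (lt_of_lt_of_le hi (hℓ (by omega)))
    have h2 := stg_det G σ0 d d' j h1
    have h3 : d j = d' j := by
      apply hG2 j (stg G σ0 d j)
      intro i hi
      have := h i hi
      simp only [stg] at this
      rw [← h2] at this
      exact this
    intro i hi
    rcases Nat.lt_succ_iff_lt_or_eq.mp hi with h4 | rfl
    · exact h1 i h4
    · exact h3

/-- The limit sequence. -/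
def limSeq (d : ∀ j, Fin (N j) → Bool) (i : ℕ) : α := (stg G σ0 d (i+1)).1 i

theorem limSeq_eq (hℓ : Monotone ℓ) (hℓ2 : ∀ j, j ≤ ℓ j)
    (hG : ∀ j σ f, ∀ i < ℓ j, (G j σ f).1 i = σ.1 i)
    (d : ∀ j, Fin (N j) → Bool) (j i : ℕ) (hi : i < ℓ j) :
    limSeq G σ0 d i = (stg G σ0 d j).1 i := by
  unfold limSeq
  rcases le_total j (i+1) with h | h
  · exact stg_stable G σ0 ℓ hℓ hG d _ _ h i hi
  · exact (stg_stable G σ0 ℓ hℓ hG d _ _ h i (hℓ2 (i+1))).symm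

theorem meas_factor {β : Type} [MeasurableSpace β] (f : (∀ j, Fin (N j) → Bool) → β) (j : ℕ)
    (hf : ∀ d d', (∀ i < j, d i = d' i) → f d = f d') : Measurable f := by
  let g : (∀ i : Fin j, Fin (N i) → Bool) → β := fun e =>
    f (fun i => if h : i < j then e ⟨i, h⟩ else fun _ => false)
  have h1 : f = g ∘ (fun d (i : Fin j) => d i) := by
    funext d
    apply hf
    intro i hi
    simp [hi]
  rw [h1]
  have hg : Measurable g := Measurable.of_discrete
  exact hg.comp (measurable_pi_lambda _ (fun i => measurable_pi_apply _))

/-- The uniform product measure. -/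
noncomputable def pms (N : ℕ → ℕ) : Measure (∀ j, Fin (N j) → Bool) :=
  Measure.infinitePi (fun j => (PMF.uniformOfFintype (Fin (N j) → Bool)).toMeasure)

instance (N : ℕ → ℕ) : IsProbabilityMeasure (pms N) := by
  unfold pms; infer_instance

theorem pms_bound (N : ℕ → ℕ) (j : ℕ) (d0 : ∀ j, Fin (N j) → Bool) (E : Finset (Fin (N j) → Bool)) :
    pms N {d | (∀ i < j, d i = d0 i) ∧ d j ∈ E} ≤
      ENNReal.ofReal ((∏ i ∈ Finset.range j, ((2:ℝ) ^ N i)⁻¹) * (E.card / 2 ^ N j)) := by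
  classical
  have hsub : {d : ∀ j, Fin (N j) → Bool | (∀ i < j, d i = d0 i) ∧ d j ∈ E} ⊆
      Set.pi (Finset.range (j+1) : Finset ℕ) (fun i => {f | (i < j → f = d0 i) ∧ (∀ h : i = j, (h ▸ f) ∈ E)}) := by
    rintro d ⟨h1, h2⟩ i hi
    refine ⟨fun h => h1 i h, ?_⟩
    rintro rfl
    exact h2
  refine (measure_mono hsub).trans ?_
  unfold pms
  rw [Measure.infinitePi_pi _ (fun i _ => Set.Finite.measurableSet (Set.toFinite _)),
    Finset.prod_range_succ, ENNReal.ofReal_mul (Finset.prod_nonneg (fun i _ => by positivity)),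
    ENNReal.ofReal_prod_of_nonneg (fun i _ => by positivity)]
  apply mul_le_mul'
  · apply Finset.prod_le_prod'
    intro i hi
    have hi' : i < j := Finset.mem_range.mp hi
    have : {f : Fin (N i) → Bool | (i < j → f = d0 i) ∧ (∀ h : i = j, (h ▸ f) ∈ E)} ⊆ {d0 i} := by
      rintro f ⟨h1, _⟩
      exact h1 hi'
    refine (measure_mono this).trans ?_
    rw [PMF.toMeasure_uniformOfFintype_apply _ (Set.Finite.measurableSet (Set.toFinite _))]
    simp [ENNReal.ofReal_inv_of_pos]
  · have : {f : Fin (N j) → Bool | (j < j → f = d0 j) ∧ (∀ h : j = j, (h ▸ f) ∈ E)} ⊆ (E : Set _) := by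
      rintro f ⟨_, h1⟩
      exact h1 rfl
    refine (measure_mono this).trans ?_
    rw [PMF.toMeasure_uniformOfFintype_apply _ (Set.Finite.measurableSet (Set.toFinite _)),
      ENNReal.ofReal_div_of_pos (by positivity)]
    simp [ENNReal.ofReal_pow]

theorem num_bound (s C lk Sj y : ℝ) (hs0 : 0 < s) (hs1 : s ≤ 1) (A B : ℝ) (L : ℕ)
    (hA : A = Real.exp (-Sj)) (hB1 : B ≤ 1) (hB : B ≤ Real.exp y)
    (h : s * (y + L * lk) ≤ Sj + C) : A * B ≤ Real.exp C * Real.exp (-(s * L * lk)) := by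
  have h1 : B ≤ Real.exp (s * y) := by
    rcases le_total 0 y with hy | hy
    · exact hB1.trans (Real.one_le_exp (by positivity))
    · exact hB.trans (Real.exp_le_exp.mpr (by nlinarith))
  rw [hA]
  calc Real.exp (-Sj) * B ≤ Real.exp (-Sj) * Real.exp (s * y) := by gcongr
    _ = Real.exp (-Sj + s * y) := (Real.exp_add _ _).symm
    _ ≤ Real.exp (C + -(s * L * lk)) := Real.exp_le_exp.mpr (by linarith)
    _ = _ := Real.exp_add _ _

theorem dim_lower [Fintype α] (b : ℕ) (hb : 2 ≤ b) (hk : 2 ≤ Fintype.card α)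
    (val : α → Fin b) (hval : Function.Injective val)
    (hℓ : Monotone ℓ) (hℓ2 : ∀ j, j ≤ ℓ j) (τ0 : ℕ → α) (hτ0 : Q 0 τ0)
    (hext : ∀ j σ, Q j σ → ∃ G : (Fin (N j) → Bool) → ℕ → α,
      (∀ f, ∀ i < ℓ j, G f i = σ i) ∧ (∀ f, Q (j+1) (G f)) ∧
      ∀ f f', (∀ i < ℓ (j+1), G f i = G f' i) → f = f')
    (s C : ℝ) (hs0 : 0 < s) (hs1 : s ≤ 1)
    (hnum : ∀ j, s * (ℓ (j+1) * Real.log (Fintype.card α) - N j * Real.log 2) ≤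
      (∑ i ∈ Finset.range j, (N i : ℝ)) * Real.log 2 + C)
    (S : Set ℝ) (hS : ∀ ω : ℕ → α, (∀ j, ∃ σ, Q j σ ∧ ∀ i < ℓ j, ω i = σ i) →
      Real.ofDigits (fun i => val (ω i)) ∈ S) :
    ENNReal.ofReal (s * (Real.log (Fintype.card α) / Real.log b)) ≤ dimH S := by
  classical
  choose G0 hG1 hG2 hG3 using hext
  let G : ∀ j, {σ : ℕ → α // Q j σ} → (Fin (N j) → Bool) → {σ : ℕ → α // Q (j+1) σ} :=
    fun j σ f => ⟨G0 j σ.1 σ.2 f, hG2 j σ.1 σ.2 f⟩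
  let σ0 : {σ : ℕ → α // Q 0 σ} := ⟨τ0, hτ0⟩
  have hGa : ∀ j σ f, ∀ i < ℓ j, (G j σ f).1 i = σ.1 i := fun j σ f i hi => hG1 j σ.1 σ.2 f i hi
  have hGb : ∀ j σ f f', (∀ i < ℓ (j+1), (G j σ f).1 i = (G j σ f').1 i) → f = f' :=
    fun j σ f f' h => hG3 j σ.1 σ.2 f f' h
  have hbR : (1:ℝ) < b := by exact_mod_cast (by omega : 1 < b)
  have hkR : (1:ℝ) < Fintype.card α := by exact_mod_cast (by omega : 1 < Fintype.card α)
  have hlk := Real.log_pos hkR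
  have hlb := Real.log_pos hbR
  set lk := Real.log (Fintype.card α) with hlkdef
  refine frostman (pms N) b hb (fun d i => val (limSeq G σ0 d i)) ?_ _ (by positivity) (Real.exp C)
    (Real.exp_pos C) ?_ S ?_
  · intro i
    apply meas_factor _ (i+1)
    intro d d' h
    simp only [limSeq]
    rw [stg_det G σ0 d d' (i+1) h]
  · intro L u
    rcases Set.eq_empty_or_nonempty {d | ∀ i < L, val (limSeq G σ0 d i) = u i} with h | ⟨d0, hd0⟩
    · rw [h]; simp
    have hex : ∃ j, L ≤ ℓ (j+1) := ⟨L, (Nat.le_succ L).trans (hℓ2 _)⟩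
    set j := Nat.find hex with hj
    have hj1 : L ≤ ℓ (j+1) := Nat.find_spec hex
    have hj2 : j = 0 ∨ ℓ j < L := by
      rcases Nat.eq_zero_or_pos j with h | h
      · exact Or.inl h
      · right
        have := Nat.find_min hex (m := j - 1) (by omega)
        rw [Nat.sub_add_cancel h] at this
        omega
    have hlim := limSeq_eq G σ0 ℓ hℓ hℓ2 hGa
    set τ := stg G σ0 d0 j with hτ
    let E : Finset (Fin (N j) → Bool) :=
      Finset.univ.filter (fun f => ∀ i < L, (G j τ f).1 i = limSeq G σ0 d0 i)
    have hsub : {d | ∀ i < L, val (limSeq G σ0 d i) = u i} ⊆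
        {d | (∀ i < j, d i = d0 i) ∧ d j ∈ E} := by
      intro d hd
      have hd' : ∀ i < L, limSeq G σ0 d i = limSeq G σ0 d0 i := fun i hi =>
        hval ((hd i hi).trans (hd0 i hi).symm)
      have h1 : ∀ i < j, d i = d0 i := by
        rcases hj2 with h | h
        · intro i hi; omega
        · apply stg_inj G σ0 ℓ hℓ hGa hGb
          intro i hi
          rw [← hlim d j i hi, ← hlim d0 j i hi]
          exact hd' i (by omega)
      refine ⟨h1, ?_⟩
      simp only [E, Finset.mem_filter, Finset.mem_univ, true_and]
      intro i hi
      rw [← hd' i hi, hlim d (j+1) i (by omega), hτ, ← stg_det G σ0 d d0 j h1]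
      rfl
    have hE1 : E.card ≤ 2 ^ N j := by
      refine (Finset.card_le_univ E).trans ?_
      simp
    have hE2 : E.card ≤ Fintype.card α ^ (ℓ (j+1) - L) := by
      have := Finset.card_le_card_of_injOn (s := E) (t := (Finset.univ : Finset (Fin (ℓ (j+1) - L) → α)))
        (fun f i => (G j τ f).1 (L + i)) (fun _ _ => Finset.mem_univ _) (by
          intro f hf f' hf' hff
          simp only [E, Finset.coe_filter, Finset.mem_univ, true_and, Set.mem_ofPred_eq] at hf hf'
          apply hGb j τ
          intro i hi
          rcases lt_or_ge i L with h | h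
          · rw [hf i h, hf' i h]
          · have := congrFun hff ⟨i - L, by omega⟩
            simp only at this
            rwa [show L + (i - L) = i by omega] at this)
      simpa using this
    refine (measure_mono hsub).trans ((pms_bound N j d0 E).trans (ENNReal.ofReal_le_ofReal ?_))
    have hpow : ((b:ℝ)⁻¹ ^ L) ^ (s * (lk / Real.log b)) = Real.exp (-(s * L * lk)) := by
      rw [Real.rpow_def_of_pos (by positivity), Real.log_pow, Real.log_inv]
      congr 1
      field_simp
    rw [hpow]
    apply num_bound s C lk ((∑ i ∈ Finset.range j, (N i : ℝ)) * Real.log 2)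
      ((ℓ (j+1) - L) * lk - N j * Real.log 2) hs0 hs1
    · rw [Finset.prod_inv_distrib, Finset.prod_pow_eq_pow_sum, Real.exp_neg, ← Nat.cast_sum,
        Real.exp_nat_mul, Real.exp_log (by norm_num)]
    · rw [div_le_one (by positivity)]
      exact_mod_cast hE1
    · rw [Real.exp_sub, Real.exp_nat_mul, Real.exp_log (by norm_num), ← Nat.cast_sub hj1,
        Real.exp_nat_mul, hlkdef, Real.exp_log (by linarith)]
      gcongr
      exact_mod_cast hE2
    · refine le_trans (le_of_eq ?_) (hnum j)
      ring
  · intro d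
    apply hS
    intro j
    exact ⟨(stg G σ0 d j).1, (stg G σ0 d j).2, fun i hi => limSeq_eq G σ0 ℓ hℓ hℓ2 hGa d j i hi⟩

end Tree


section Final
open MeasureTheory Filter Topology
open scoped ENNReal NNReal

theorem num_core (s c q k D : ℝ) (hq : 8 ≤ q) (hk : 0 < k)
    (hs : s < c / ((q - 1) * (q - c))) (hc2 : c ≤ 2) :
    ∃ C : ℝ, ∀ j : ℕ, s * ((q - c) * (k * q ^ j) + D * (j + 1)) ≤
      c * ((k * q ^ j - k) / (q - 1)) + C := by
  have hqc : 0 < q - c := by linarith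
  have hq1 : 0 < q - 1 := by linarith
  set ε := c / (q - 1) - s * (q - c) with hε
  have hεpos : 0 < ε := by
    have : s * (q - c) < c / ((q - 1) * (q - c)) * (q - c) := by gcongr
    have h2 : c / ((q - 1) * (q - c)) * (q - c) = c / (q - 1) := by field_simp
    rw [hε]; linarith
  refine ⟨c * k / (q - 1) + (s * D) ^ 2 / (4 * (ε * k)), fun j => ?_⟩
  have h1 : ((j:ℝ) + 1) ^ 2 ≤ q ^ j := by
    have h2 : ((j:ℝ) + 1) ≤ 2 ^ j := by
      exact_mod_cast (Nat.lt_two_pow_self (n := j))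
    calc ((j:ℝ) + 1) ^ 2 ≤ (2 ^ j) ^ 2 := by gcongr
      _ = (4:ℝ) ^ j := by rw [← pow_mul, mul_comm, pow_mul]; norm_num
      _ ≤ q ^ j := by gcongr; linarith
  have hek : 0 < ε * k := by positivity
  have h3 : s * D * (j + 1) ≤ ε * k * (j + 1) ^ 2 + (s * D) ^ 2 / (4 * (ε * k)) := by
    have : ε * k * ((j:ℝ) + 1) ^ 2 + (s * D) ^ 2 / (4 * (ε * k)) - s * D * (j + 1)
        = (2 * (ε * k) * (j + 1) - s * D) ^ 2 / (4 * (ε * k)) := by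
      field_simp; ring
    have h4 : 0 ≤ (2 * (ε * k) * ((j:ℝ) + 1) - s * D) ^ 2 / (4 * (ε * k)) := by positivity
    linarith
  have h5 : ε * k * ((j:ℝ) + 1) ^ 2 ≤ ε * k * q ^ j := by gcongr
  have h6 : c * ((k * q ^ j - k) / (q - 1)) + (c * k / (q - 1) + (s * D) ^ 2 / (4 * (ε * k)))
      = c / (q - 1) * (k * q ^ j) + (s * D) ^ 2 / (4 * (ε * k)) := by
    field_simp; ring
  rw [h6]
  have h7 : c / (q - 1) = ε + s * (q - c) := by rw [hε]; ring
  rw [h7]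
  nlinarith

theorem DB_one {α : Type} [Fintype α] (hk : 0 < Fintype.card α) : ∃ σ : ℕ → α, DB 1 σ := by
  have e := (Fintype.equivFin α).symm
  refine ⟨fun i => if h : i < Fintype.card α then e ⟨i, h⟩ else e ⟨0, hk⟩, ?_⟩
  intro i hi j hj hij
  simp only [Set.mem_Iio, pow_one] at hi hj
  have := (win_eq_iff 1 _ _ i j).mp hij 0 one_pos
  simp only [add_zero, hi, hj, dif_pos] at this
  have h2 := e.injective this
  simpa using h2

theorem DB_dbPrefix (A : Finset ℕ) (n : ℕ) (ω : ℕ → A) (hA : 0 < A.card) (h : DB n ω) :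
    dbPrefix A n (fun i => (ω i : ℕ)) := by
  have hc : Fintype.card A = A.card := Fintype.card_coe A
  have hpos : 0 < A.card ^ n := by positivity
  intro v hv
  obtain ⟨j, hj, hjx⟩ := DB_surj n ω h (fun i => ⟨v i, hv i i.2⟩)
  rw [hc] at hj
  refine ⟨j, ⟨by omega, ?_⟩, ?_⟩
  · intro i hi
    have := congrFun hjx ⟨i, hi⟩
    simp only [win] at this
    simp [this]
  · rintro j' ⟨h1, h2⟩
    apply h
    · simp only [Set.mem_Iio, hc]; omega
    · simpa only [Set.mem_Iio, hc] using hj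
    · rw [hjx]
      funext i
      apply Subtype.ext
      exact h2 i i.2

theorem core (b : ℕ) (hb : 2 ≤ b) (A : Finset ℕ) (hAb : A ⊆ Finset.range b) (hA : 2 ≤ A.card)
    (m Δ : ℕ) (c : ℝ) (hc : m * Real.log 2 = c * Real.log A.card) (hc0 : 0 < c) (hc2 : c ≤ 2)
    (hq : 8 ≤ (A.card : ℝ) ^ Δ) (hΔ : 0 < Δ)
    (hext : ∀ n, 1 ≤ n → ∀ σ : ℕ → A, DB n σ →
      ∃ G : (Fin (m * A.card ^ n) → Bool) → ℕ → A,
        (∀ f, ∀ i < A.card ^ n + n - 1, G f i = σ i) ∧ (∀ f, DB (n+Δ) (G f)) ∧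
        ∀ f f', (∀ i < A.card ^ (n+Δ) + (n+Δ) - 1, G f i = G f' i) → f = f')
    (S : Set ℝ)
    (hS : S = {x : ℝ | ∃ ω : ℕ → ℕ, (∀ i, ω i ∈ A) ∧
      (∃ a : ℕ, ∀ m : ℕ, a + m * Δ ∈ deBruijnSet A ω) ∧ x = baseVal b ω}) :
    ENNReal.ofReal (c / (((A.card : ℝ) ^ Δ - 1) * ((A.card : ℝ) ^ Δ - c)) *
      (Real.log A.card / Real.log b)) ≤ dimH S := by
  have hcard : Fintype.card A = A.card := Fintype.card_coe A
  set k := A.card with hk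
  set q : ℝ := (k : ℝ) ^ Δ with hqdef
  set lk := Real.log k with hlk
  have hkR : (1:ℝ) < k := by exact_mod_cast (by omega : 1 < k)
  have hlk0 : 0 < lk := Real.log_pos hkR
  have hq1 : 0 < q - 1 := by linarith
  have hqc : 0 < q - c := by linarith
  set a := c / ((q - 1) * (q - c)) with ha
  have ha0 : 0 < a := by positivity
  have ha1 : a ≤ 1 := by
    rw [ha, div_le_one (by positivity)]
    nlinarith
  have main : ∀ s, 0 < s → s < a → ENNReal.ofReal (s * (lk / Real.log b)) ≤ dimH S := by
    intro s hs0 hs1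
    obtain ⟨C, hC⟩ := num_core s c q k Δ hq (by linarith) hs1 hc2
    obtain ⟨τ0, hτ0⟩ := DB_one (α := A) (by omega)
    have hpow : ∀ j : ℕ, (k:ℝ) ^ (1 + Δ * j) = k * q ^ j := by
      intro j
      rw [hqdef, ← pow_mul, pow_add, pow_one]
    have := dim_lower (α := A) (N := fun j => m * k ^ (1 + Δ * j))
      (Q := fun j σ => DB (1 + Δ * j) σ) (fun j => k ^ (1 + Δ * j) + Δ * j) b hb (by omega)
      (fun x => ⟨x.1, Finset.mem_range.mp (hAb x.2)⟩)
      (fun x y hxy => Subtype.ext (congrArg Fin.val hxy))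
      (by
        intro i j hij
        have h1 : Δ * i ≤ Δ * j := Nat.mul_le_mul_left _ hij
        have h2 : k ^ (1 + Δ * i) ≤ k ^ (1 + Δ * j) := Nat.pow_le_pow_right (by omega) (by omega)
        simp only
        omega)
      (by
        intro j
        have h1 : 1 * j ≤ Δ * j := Nat.mul_le_mul_right _ hΔ
        omega)
      τ0 (by simpa using hτ0)
      (by
        intro j σ hσ
        obtain ⟨G, h1, h2, h3⟩ := hext (1 + Δ * j) (by omega) σ hσ
        have e1 : 1 + Δ * j + Δ = 1 + Δ * (j + 1) := by ring
        rw [e1] at h2 h3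
        refine ⟨G, ?_, h2, ?_⟩
        · intro f i hi
          exact h1 f i (by omega)
        · intro f f' hf
          exact h3 f f' (fun i hi => hf i (by omega)))
      s (C * lk) hs0 (by linarith)
      (by
        intro j
        have hsum : (∑ i ∈ Finset.range j, ((m * k ^ (1 + Δ * i) : ℕ) : ℝ)) * Real.log 2
            = c * ((k * q ^ j - k) / (q - 1)) * lk := by
          have : ∀ i ∈ Finset.range j, ((m * k ^ (1 + Δ * i) : ℕ) : ℝ) = m * k * q ^ i := by
            intro i _
            push_cast
            rw [hpow]; ring
          rw [Finset.sum_congr rfl this, ← Finset.mul_sum, geom_sum_eq (by linarith)]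
          calc (m:ℝ) * k * ((q ^ j - 1) / (q - 1)) * Real.log 2
              = (m * Real.log 2) * (k * ((q ^ j - 1) / (q - 1))) := by ring
            _ = _ := by rw [hc]; ring
        rw [hsum, hcard]
        have := mul_le_mul_of_nonneg_right (hC j) hlk0.le
        refine le_trans (le_of_eq ?_) (this.trans (le_of_eq (by ring)))
        push_cast
        rw [hpow, hpow, pow_succ]
        have : (m:ℝ) * (k * q ^ j) * Real.log 2 = c * lk * (k * q ^ j) := by
          rw [← hc]; ring
        rw [this]
        ring)
      S ?_
    · rw [hcard] at this
      exact this
    · intro ω hω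
      rw [hS]
      refine ⟨fun i => (ω i : ℕ), fun i => (ω i).2, ⟨1, fun j => ?_⟩, ?_⟩
      · obtain ⟨σ, h1, h2⟩ := hω j
        refine ⟨by omega, ?_⟩
        rw [mul_comm j Δ]
        apply DB_dbPrefix _ _ _ (by omega)
        apply DB_congr _ σ ω _ h1
        intro i hi
        rw [hcard] at hi
        exact h2 i (by omega)
      · simp only [baseVal, Real.ofDigits, Real.ofDigitsTerm, div_eq_mul_inv]
  have hlim : Tendsto (fun s : ℝ => ENNReal.ofReal (s * (lk / Real.log b))) (𝓝[<] a)
      (𝓝 (ENNReal.ofReal (a * (lk / Real.log b)))) := by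
    apply Tendsto.mono_left _ nhdsWithin_le_nhds
    apply ENNReal.tendsto_ofReal
    exact tendsto_id.mul_const _
  refine le_of_tendsto hlim ?_
  filter_upwards [Ioo_mem_nhdsLT ha0] with s hs
  exact main s hs.1 hs.2

end Final

/-- Theorem (lower bound, `k ≤ 3`): with `α_2 = 1/49`, `Δ = 3` when `k = 2` and
`α_3 = (8(9 log_4 3 − 1))⁻¹`, `Δ = 2` when `k = 3`, the set of points of `F` having a
base-`b` expansion `ω` such that `B_ω` contains an infinite arithmetic progression with
common difference `Δ` has Hausdorff dimension at least `α_k·δ`. -/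
theorem statement3 (b : ℕ) (hb : 2 ≤ b) (A : Finset ℕ) (hAb : A ⊆ Finset.range b)
    (k : ℕ) (hk : k = A.card) (hk23 : k = 2 ∨ k = 3)
    (δ : ℝ) (hδ : δ = Real.log k / Real.log b)
    (α : ℝ) (hα : α = if k = 2 then 1 / 49 else (8 * (9 * Real.logb 4 3 - 1))⁻¹)
    (Δ : ℕ) (hΔ : Δ = if k = 2 then 3 else 2)
    (S : Set ℝ)
    (hS : S = {x : ℝ | ∃ ω : ℕ → ℕ, (∀ i, ω i ∈ A) ∧
      (∃ a : ℕ, ∀ m : ℕ, a + m * Δ ∈ deBruijnSet A ω) ∧ x = baseVal b ω}) :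
    ENNReal.ofReal (α * δ) ≤ dimH S := by
  have hcard : Fintype.card A = A.card := Fintype.card_coe A
  rcases hk23 with h2 | h3
  · have hA : A.card = 2 := by omega
    simp only [h2, if_true] at hα hΔ
    have := core b hb A hAb (by omega) 1 Δ 1 (by rw [hA]; push_cast; ring) (by norm_num) (by norm_num)
      (by rw [hA, hΔ]; norm_num) (by omega)
      (by
        intro n hn σ hσ
        have := many_two (α := A) (by omega) n hn σ hσ
        rw [hcard, hA] at this
        rw [hA, hΔ, one_mul]
        exact this) S hS
    refine le_trans (le_of_eq ?_) this
    rw [hα, hδ, hΔ, hA, h2]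
    norm_num
  · have hA : A.card = 3 := by omega
    have h32 : k ≠ 2 := by omega
    simp only [h32, if_false] at hα hΔ
    have hl3 : 0 < Real.log 3 := Real.log_pos (by norm_num)
    have hl4 : 0 < Real.log 4 := Real.log_pos (by norm_num)
    have hl42 : Real.log 4 = 2 * Real.log 2 := by
      rw [show (4:ℝ) = 2 ^ 2 by norm_num, Real.log_pow]; norm_num
    have hl34 : Real.log 4 ≤ 2 * Real.log 3 := by
      rw [hl42]
      have := Real.log_le_log (by norm_num : (0:ℝ) < 2) (by norm_num : (2:ℝ) ≤ 3)
      linarith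
    have := core b hb A hAb (by omega) 2 Δ (Real.log 4 / Real.log 3)
      (by rw [hA]; push_cast; rw [← hl42]; field_simp) (by positivity)
      (by rw [div_le_iff₀ hl3]; exact hl34)
      (by rw [hA, hΔ]; norm_num) (by omega)
      (by
        intro n hn σ hσ
        have := many_three (α := A) (by omega) n hn σ hσ
        rw [hcard, hA] at this
        rw [hA, hΔ]
        exact this) S hS
    refine le_trans (le_of_eq ?_) this
    rw [hα, hδ, hΔ, hA, h3]
    congr 2
    rw [Real.logb]
    have h9 : 0 < 9 * Real.log 3 - Real.log 4 := by linarith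
    have e1 : 8 * (9 * (Real.log 3 / Real.log 4) - 1) = 8 * (9 * Real.log 3 - Real.log 4) / Real.log 4 := by
      field_simp
    have e2 : (((3:ℕ):ℝ) ^ 2 - 1) * (((3:ℕ):ℝ) ^ 2 - Real.log 4 / Real.log 3)
        = 8 * (9 * Real.log 3 - Real.log 4) / Real.log 3 := by
      field_simp; norm_num; ring
    rw [e1, e2, inv_div]
    field_simp
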